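/- arXiv:1111.1592 — 4 statements merged into one kernel-verified Lean document; each statement's English description precedes it below -/
import Mathlib

section
/- Let G be a graph with finitely many vertices and let v ∈ G⁰ be a regular vertex that is not a source and that emits exactly one edge f₀, and suppose f₀ is not a loop of length one (i.e. r(f₀) ≠ v). Let E be the graph obtained from G by deleting v, the edge f₀, and all edges into v, and adding for each edge e with r(e) = v a new edge [e f₀] with source s(e) and range r(f₀). Then G ∼_M E. -/
/-- A directed graph as used in the theory of graph `C*`-algebras:
a type of vertices, a type of edges, and range and source maps. -/
structure CKGraph : Type 1 where
  V : Type
  E : Type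
  r : E → V
  s : E → V

namespace CKGraph

/-- An isomorphism of graphs: bijections of vertices and edges intertwining
the range and source maps. -/
structure Iso (G H : CKGraph) where
  vEquiv : G.V ≃ H.V
  eEquiv : G.E ≃ H.E
  map_r : ∀ e, H.r (eEquiv e) = vEquiv (G.r e)
  map_s : ∀ e, H.s (eEquiv e) = vEquiv (G.s e)

/-- A vertex is a source if it receives no edges. -/
def IsSource (G : CKGraph) (v : G.V) : Prop := ∀ e, G.r e ≠ v

/-- A vertex is a sink if it emits no edges. -/
def IsSink (G : CKGraph) (v : G.V) : Prop := ∀ e, G.s e ≠ v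

/-- A vertex is an infinite emitter if it emits infinitely many edges. -/
def IsInfiniteEmitter (G : CKGraph) (v : G.V) : Prop := {e | G.s e = v}.Infinite

/-- A vertex is regular if it is neither a sink nor an infinite emitter. -/
def Regular (G : CKGraph) (v : G.V) : Prop :=
  (∃ e, G.s e = v) ∧ {e | G.s e = v}.Finite

/-- There is a (nonempty) path from `u` to `v` in `G`. -/
inductive HasPath (G : CKGraph) : G.V → G.V → Prop
  | single (e : G.E) : HasPath G (G.s e) (G.r e)
  | cons (e : G.E) {v : G.V} : HasPath G (G.r e) v → HasPath G (G.s e) v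

/-- `G.Geq u v` is the relation `u ≥ v`: `u = v` or there is a path from `u` to `v`. -/
def Geq (G : CKGraph) (u v : G.V) : Prop := u = v ∨ G.HasPath u v

/-- There is a (nonempty) path from `u` to `v` all of whose vertices lie in `S`. -/
inductive HasPathIn (G : CKGraph) (S : Set G.V) : G.V → G.V → Prop
  | single (e : G.E) : G.s e ∈ S → G.r e ∈ S → HasPathIn G S (G.s e) (G.r e)
  | cons (e : G.E) {v : G.V} : G.s e ∈ S → HasPathIn G S (G.r e) v →
      HasPathIn G S (G.s e) v

/-- The nonempty list of edges `l` is a path from `u` to `v`. -/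
def IsPathFromTo (G : CKGraph) (l : List G.E) (u v : G.V) : Prop :=
  ∃ h : l ≠ [], l.Chain' (fun e f => G.r e = G.s f) ∧
    G.s (l.head h) = u ∧ G.r (l.getLast h) = v

/-- The list of edges `l` is a simple loop based at `v`: a loop at `v` such that the
range of every non-final edge is different from `v`. -/
def IsSimpleLoopAt (G : CKGraph) (v : G.V) (l : List G.E) : Prop :=
  G.IsPathFromTo l v v ∧ ∀ e ∈ l.dropLast, G.r e ≠ v

/-- A set of vertices is hereditary if it contains the range of every edge whose
source it contains. -/
def Hereditary (G : CKGraph) (H : Set G.V) : Prop := ∀ e, G.s e ∈ H → G.r e ∈ H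

/-- A set of vertices is saturated if it contains every regular vertex all of whose
emitted edges have range in the set. -/
def Saturated (G : CKGraph) (H : Set G.V) : Prop :=
  ∀ v, G.Regular v → (∀ e, G.s e = v → G.r e ∈ H) → v ∈ H

/-- Move (S): removing the (regular) source `v` together with all edges it emits. -/
def removeSource (G : CKGraph) (v : G.V) (hsrc : G.IsSource v) : CKGraph where
  V := {w : G.V // w ≠ v}
  E := {e : G.E // G.s e ≠ v}
  r e := ⟨G.r e.1, hsrc e.1⟩
  s e := ⟨G.s e.1, e.2⟩

/-- Move (R): the reduction at a vertex `u` that emits exactly one edge `f` with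
`r f ≠ u` and receives only from the single vertex `v`. -/
def reduce (G : CKGraph) (u : G.V) (f : G.E) (hf : G.s f = u) (hrf : G.r f ≠ u)
    (honly : ∀ e, G.s e = u → e = f) (v : G.V) (hin : ∀ e, G.r e = u → G.s e = v) :
    CKGraph where
  V := {w : G.V // w ≠ u}
  E := {e : G.E // G.r e ≠ u ∧ e ≠ f} ⊕ {e : G.E // G.r e = u}
  r x :=
    match x with
    | .inl e => ⟨G.r e.1, e.2.1⟩
    | .inr _ => ⟨G.r f, hrf⟩
  s x :=
    match x with
    | .inl e => ⟨G.s e.1, fun h => e.2.2 (honly e.1 h)⟩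
    | .inr e => ⟨G.s e.1, by
        intro h
        have h2 : G.r e.1 = u := e.2
        rw [honly e.1 h] at h2
        exact hrf h2⟩

/-- Move (O): the out-split of `G` at `v` according to the partition of `s⁻¹(v)`
into the fibres of `P`. -/
noncomputable def outSplit (G : CKGraph) (v : G.V) (n : ℕ)
    (P : {e : G.E // G.s e = v} → Fin n) : CKGraph :=
  letI := Classical.decEq G.V
  { V := {w : G.V // w ≠ v} ⊕ Fin n
    E := {e : G.E // G.r e ≠ v} ⊕ ({e : G.E // G.r e = v} × Fin n)
    r := fun x =>
      match x with
      | .inl e => Sum.inl ⟨G.r e.1, e.2⟩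
      | .inr p => Sum.inr p.2
    s := fun x =>
      match x with
      | .inl e =>
          if h : G.s e.1 = v then Sum.inr (P ⟨e.1, h⟩) else Sum.inl ⟨G.s e.1, h⟩
      | .inr p =>
          if h : G.s p.1.1 = v then Sum.inr (P ⟨p.1.1, h⟩)
          else Sum.inl ⟨G.s p.1.1, h⟩ }

/-- Move (I): the in-split of `G` at `v` according to the partition of `r⁻¹(v)`
into the fibres of `P`. -/
noncomputable def inSplit (G : CKGraph) (v : G.V) (n : ℕ)
    (P : {e : G.E // G.r e = v} → Fin n) : CKGraph :=
  letI := Classical.decEq G.V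
  { V := {w : G.V // w ≠ v} ⊕ Fin n
    E := {e : G.E // G.s e ≠ v} ⊕ ({e : G.E // G.s e = v} × Fin n)
    s := fun x =>
      match x with
      | .inl e => Sum.inl ⟨G.s e.1, e.2⟩
      | .inr p => Sum.inr p.2
    r := fun x =>
      match x with
      | .inl e =>
          if h : G.r e.1 = v then Sum.inr (P ⟨e.1, h⟩) else Sum.inl ⟨G.r e.1, h⟩
      | .inr p =>
          if h : G.r p.1.1 = v then Sum.inr (P ⟨p.1.1, h⟩)
          else Sum.inl ⟨G.r p.1.1, h⟩ }

/-- Move-equivalence: the smallest equivalence relation on graphs with finitely many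
vertices such that `G ∼ H` whenever `H` is obtained from `G`, up to graph
isomorphism, by one of the moves (S), (I), (O), (R). -/
inductive MoveEquiv : CKGraph → CKGraph → Prop
  | of_iso {G H : CKGraph} (hG : Finite G.V) (h : Nonempty (Iso G H)) : MoveEquiv G H
  | moveS {G : CKGraph} (hG : Finite G.V) (v : G.V) (hreg : G.Regular v)
      (hsrc : G.IsSource v) {H : CKGraph}
      (h : Nonempty (Iso H (G.removeSource v hsrc))) : MoveEquiv G H
  | moveR {G : CKGraph} (hG : Finite G.V) (u : G.V) (f : G.E) (hf : G.s f = u)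
      (hrf : G.r f ≠ u) (honly : ∀ e, G.s e = u → e = f) (v : G.V)
      (hin : ∀ e, G.r e = u → G.s e = v) {H : CKGraph}
      (h : Nonempty (Iso H (G.reduce u f hf hrf honly v hin))) : MoveEquiv G H
  | moveO {G : CKGraph} (hG : Finite G.V) (v : G.V) (hns : ¬ G.IsSink v) (n : ℕ)
      (P : {e : G.E // G.s e = v} → Fin n) (hsurj : Function.Surjective P)
      (hinf : ∀ i j : Fin n, {x : {e : G.E // G.s e = v} | P x = i}.Infinite →
        {x : {e : G.E // G.s e = v} | P x = j}.Infinite → i = j)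
      {H : CKGraph} (h : Nonempty (Iso H (G.outSplit v n P))) : MoveEquiv G H
  | moveI {G : CKGraph} (hG : Finite G.V) (v : G.V) (hreg : G.Regular v)
      (hns : ¬ G.IsSource v) (n : ℕ) (P : {e : G.E // G.r e = v} → Fin n)
      (hsurj : Function.Surjective P) {H : CKGraph}
      (h : Nonempty (Iso H (G.inSplit v n P))) : MoveEquiv G H
  | symm {G H : CKGraph} : MoveEquiv G H → MoveEquiv H G
  | trans {G H K : CKGraph} : MoveEquiv G H → MoveEquiv H K → MoveEquiv G K

/-- The graph obtained from `G` by collapsing a regular non-source vertex `v` that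
emits exactly one edge `f₀`, which is not a loop: delete `v`, `f₀` and all edges into
`v`, and add an edge `[e f₀]` from `s e` to `r f₀` for every edge `e` into `v`. -/
def collapseOne (G : CKGraph) (v : G.V) (f₀ : G.E) (hf : G.s f₀ = v)
    (honly : ∀ e, G.s e = v → e = f₀) (hr : G.r f₀ ≠ v) : CKGraph where
  V := {w : G.V // w ≠ v}
  E := {e : G.E // G.r e ≠ v ∧ e ≠ f₀} ⊕ {e : G.E // G.r e = v}
  r x :=
    match x with
    | .inl e => ⟨G.r e.1, e.2.1⟩
    | .inr _ => ⟨G.r f₀, hr⟩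
  s x :=
    match x with
    | .inl e => ⟨G.s e.1, fun h => e.2.2 (honly e.1 h)⟩
    | .inr e => ⟨G.s e.1, by
        intro h
        have h2 : G.r e.1 = v := e.2
        rw [honly e.1 h] at h2
        exact hr h2⟩

/-- The graph obtained from `G` by collapsing a regular vertex `v` which does not
support a loop of length one: delete `v` and all edges into or out of `v`, and add
an edge `[e f]` from `s e` to `r f` for every pair of edges `e, f` with
`r e = v = s f`. -/
def collapse (G : CKGraph) (v : G.V) (hnl : ∀ e, G.s e = v → G.r e ≠ v) :
    CKGraph where
  V := {w : G.V // w ≠ v}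
  E := {e : G.E // G.r e ≠ v ∧ G.s e ≠ v} ⊕
    ({e : G.E // G.r e = v} × {f : G.E // G.s f = v})
  s x :=
    match x with
    | .inl e => ⟨G.s e.1, e.2.2⟩
    | .inr p => ⟨G.s p.1.1, fun h => hnl p.1.1 h p.1.2⟩
  r x :=
    match x with
    | .inl e => ⟨G.r e.1, e.2.1⟩
    | .inr p => ⟨G.r p.2.1, fun h => hnl p.2.1 p.2.2 h⟩

/-- The graph obtained from `G` by adding countably infinitely many new edges,
each with source `u` and range `w`. -/
def addEdges (G : CKGraph) (u w : G.V) : CKGraph where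
  V := G.V
  E := G.E ⊕ ℕ
  r x := match x with | .inl e => G.r e | .inr _ => w
  s x := match x with | .inl e => G.s e | .inr _ => u

/-- The graph with exactly one vertex and no edges. -/
def singletonGraph : CKGraph where
  V := PUnit
  E := Empty
  r e := e.elim
  s e := e.elim

/-- The Cuntz splice of `G` at `v`: add two new vertices `u₁, u₂` and six new edges:
`v → u₁`, `u₁ → v`, a loop at `u₁`, `u₁ → u₂`, `u₂ → u₁`, and a loop at `u₂`. -/
def cuntzSplice (G : CKGraph) (v : G.V) : CKGraph where
  V := G.V ⊕ Fin 2
  E := G.E ⊕ Fin 6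
  s x :=
    match x with
    | .inl e => Sum.inl (G.s e)
    | .inr i => ![Sum.inl v, Sum.inr 0, Sum.inr 0, Sum.inr 0, Sum.inr 1, Sum.inr 1] i
  r x :=
    match x with
    | .inl e => Sum.inl (G.r e)
    | .inr i => ![Sum.inr 0, Sum.inl v, Sum.inr 0, Sum.inr 1, Sum.inr 0, Sum.inr 1] i

/-- The adjacency matrix (as an integer matrix) of a graph whose vertices are
enumerated by `Fin n`. -/
noncomputable def adjMatrix (G : CKGraph) {n : ℕ} (ρ : G.V ≃ Fin n) :
    Matrix (Fin n) (Fin n) ℤ :=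
  Matrix.of fun i j => (Nat.card {e : G.E // G.s e = ρ.symm i ∧ G.r e = ρ.symm j} : ℤ)

end CKGraph

/-- The graph of an `ℕ∞`-valued square matrix: it has exactly `A x y` edges from
`x` to `y`. -/
def graphOfMatrix {n : ℕ} (A : Matrix (Fin n) (Fin n) ℕ∞) : CKGraph where
  V := Fin n
  E := Σ x : Fin n, Σ y : Fin n, {k : ℕ // (k : ℕ∞) < A x y}
  s e := e.1
  r e := e.2.1

/-- Move-equivalence of (possibly differently sized) square matrices over `ℕ∞`. -/
def MatMoveEquiv {m n : ℕ} (A : Matrix (Fin m) (Fin m) ℕ∞)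
    (B : Matrix (Fin n) (Fin n) ℕ∞) : Prop :=
  CKGraph.MoveEquiv (graphOfMatrix A) (graphOfMatrix B)

/-- A square matrix is irreducible if any index connects to any other index through
a chain of non-zero entries. -/
def MatIrreducible {n : ℕ} {α : Type*} [Zero α] (A : Matrix (Fin n) (Fin n) α) :
    Prop :=
  ∀ i j : Fin n, ∃ (l : ℕ) (c : ℕ → Fin n), 1 ≤ l ∧ c 0 = i ∧ c l = j ∧
    ∀ t < l, A (c t) (c (t + 1)) ≠ 0

/-- `Jmat n m` is the `n × n` matrix whose top-left `m × m` block is the identity,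
whose other entries in the first `m` rows are `0`, and whose last `n - m` rows have
every entry equal to `∞`. -/
def Jmat (n m : ℕ) : Matrix (Fin n) (Fin n) ℕ∞ :=
  Matrix.of fun i j => if i.1 < m then (if i = j then 1 else 0) else ⊤

namespace CKGraph

/-- The inverse of a graph isomorphism. -/
def Iso.symm {G H : CKGraph} (φ : Iso G H) : Iso H G where
  vEquiv := φ.vEquiv.symm
  eEquiv := φ.eEquiv.symm
  map_r e := by
    rw [Equiv.eq_symm_apply, ← φ.map_r, Equiv.apply_symm_apply]
  map_s e := by
    rw [Equiv.eq_symm_apply, ← φ.map_s, Equiv.apply_symm_apply]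

/-- A pair of bijective maps intertwining range and source is an isomorphism. -/
noncomputable def Iso.ofBijective {G H : CKGraph} (p : G.V → H.V) (q : G.E → H.E)
    (hp : Function.Bijective p) (hq : Function.Bijective q)
    (hr : ∀ e, H.r (q e) = p (G.r e)) (hs : ∀ e, H.s (q e) = p (G.s e)) : Iso G H where
  vEquiv := Equiv.ofBijective p hp
  eEquiv := Equiv.ofBijective q hq
  map_r := hr
  map_s := hs

open Classical in
/-- The graph obtained from `G` by changing the range of every edge in `A` to `x`. -/
noncomputable def redirect (G : CKGraph) (A : Set G.E) (x : G.V) : CKGraph where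
  V := G.V
  E := G.E
  r e := if e ∈ A then x else G.r e
  s := G.s

theorem redirect_r_of_mem (G : CKGraph) {A : Set G.E} (x : G.V) {e : G.E} (h : e ∈ A) :
    (G.redirect A x).r e = x := if_pos h

theorem redirect_r_of_notMem (G : CKGraph) {A : Set G.E} (x : G.V) {e : G.E} (h : e ∉ A) :
    (G.redirect A x).r e = G.r e := if_neg h

/-- A vertex becomes a source when all edges into it are redirected elsewhere. -/
theorem isSource_redirect (G : CKGraph) {v x : G.V} (hx : x ≠ v) :
    (G.redirect {e | G.r e = v} x).IsSource v := by
  intro e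
  by_cases h : G.r e = v
  · rw [redirect_r_of_mem G x (A := {e | G.r e = v}) h]
    exact hx
  · rw [redirect_r_of_notMem G x (A := {e | G.r e = v}) h]
    exact h

/-- Redirecting all edges into `v` to `r f₀` turns `v` into a regular source, whose removal
is the collapse of `v`. -/
theorem moveEquiv_redirect_collapseOne (G : CKGraph) (hfin : Finite G.V) (v : G.V) (f₀ : G.E)
    (hf : G.s f₀ = v) (honly : ∀ e, G.s e = v → e = f₀) (hr : G.r f₀ ≠ v) :
    MoveEquiv (G.redirect {e | G.r e = v} (G.r f₀)) (G.collapseOne v f₀ hf honly hr) := by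
  have hreg : (G.redirect {e | G.r e = v} (G.r f₀)).Regular v :=
    ⟨⟨f₀, hf⟩, (Set.finite_singleton f₀).subset fun e he => honly e he⟩
  refine MoveEquiv.moveS (G := G.redirect {e | G.r e = v} (G.r f₀)) hfin v hreg
    (G.isSource_redirect hr) ⟨Iso.ofBijective
    (G := G.collapseOne v f₀ hf honly hr)
    (H := (G.redirect {e | G.r e = v} (G.r f₀)).removeSource v (G.isSource_redirect hr))
    id
    (Sum.elim (fun e => ⟨e.1, fun h => e.2.2 (honly e.1 h)⟩)
      (fun e => ⟨e.1, fun h => hr (honly e.1 h ▸ e.2)⟩))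
    Function.bijective_id ⟨?_, ?_⟩ ?_ ?_⟩
  · rintro (⟨e, he⟩ | ⟨e, he⟩) (⟨e', he'⟩ | ⟨e', he'⟩) h <;>
      obtain rfl : e = e' := congrArg Subtype.val h
    · rfl
    · exact absurd he' he.1
    · exact absurd he he'.1
    · rfl
  · rintro ⟨e, he⟩
    by_cases h : G.r e = v
    · exact ⟨.inr ⟨e, h⟩, rfl⟩
    · exact ⟨.inl ⟨e, h, fun h' => he (h' ▸ hf)⟩, rfl⟩
  · rintro (⟨e, he⟩ | ⟨e, he⟩)
    · exact Subtype.ext (redirect_r_of_notMem G _ (A := {e | G.r e = v}) he.1)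
    · exact Subtype.ext (redirect_r_of_mem G _ (A := {e | G.r e = v}) he)
  · rintro (⟨e, he⟩ | ⟨e, he⟩) <;> rfl

/-- The collapse of a vertex which receives edges from only one vertex is a move (R). -/
theorem moveEquiv_collapseOne_of_forall_source_eq (G : CKGraph) (hfin : Finite G.V) (v : G.V)
    (f₀ : G.E) (hf : G.s f₀ = v) (honly : ∀ e, G.s e = v → e = f₀) (hr : G.r f₀ ≠ v) (a : G.V)
    (ha : ∀ e, G.r e = v → G.s e = a) : MoveEquiv G (G.collapseOne v f₀ hf honly hr) :=
  MoveEquiv.moveR hfin v f₀ hf hr honly a ha ⟨Iso.ofBijective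
    (G := G.collapseOne v f₀ hf honly hr) (H := G.reduce v f₀ hf hr honly a ha) id id
    Function.bijective_id Function.bijective_id
    (by rintro (e | e) <;> rfl) (by rintro (e | e) <;> rfl)⟩

open Classical in
/-- Splitting off the edges into `v` which come from `a`, and then reducing the new vertex,
redirects these edges to the range of the only edge emitted by `v`. -/
theorem moveEquiv_redirect_of_split (G : CKGraph) (hfin : Finite G.V) (v : G.V) (f₀ : G.E)
    (hf : G.s f₀ = v) (honly : ∀ e, G.s e = v → e = f₀) (hr : G.r f₀ ≠ v) (a : G.V)
    (hex : ∃ e, G.r e = v ∧ G.s e = a) (hex' : ∃ e, G.r e = v ∧ G.s e ≠ a) :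
    MoveEquiv G (G.redirect {e | G.r e = v ∧ G.s e = a} (G.r f₀)) := by
  obtain ⟨e₀, he₀, he₀a⟩ := hex
  obtain ⟨e₁, he₁, he₁a⟩ := hex'
  let P : {e : G.E // G.r e = v} → Fin 2 := fun e => if G.s e.1 = a then 0 else 1
  have hP : ∀ e, P e = 0 ↔ G.s e.1 = a := fun e => by
    by_cases h : G.s e.1 = a <;> simp [P, h]
  have hsurj : Function.Surjective P := by
    intro i
    fin_cases i
    · exact ⟨⟨e₀, he₀⟩, by simp [P, he₀a]⟩
    · exact ⟨⟨e₁, he₁⟩, by simp [P, he₁a]⟩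
  have hns : ∀ e, G.r e = v → G.s e ≠ v := fun e he h => hr (honly e h ▸ he)
  have hreg : G.Regular v :=
    ⟨⟨f₀, hf⟩, (Set.finite_singleton f₀).subset fun e he => honly e he⟩
  let K := G.inSplit v 2 P
  have hKr_pos : ∀ (e : {e : G.E // G.s e ≠ v}) (h : G.r e.1 = v),
      K.r (.inl e) = .inr (P ⟨e.1, h⟩) := fun e h => dif_pos h
  have hKr_neg : ∀ (e : {e : G.E // G.s e ≠ v}) (h : G.r e.1 ≠ v),
      K.r (.inl e) = .inl ⟨G.r e.1, h⟩ := fun e h => dif_neg h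
  have hKr' : ∀ p : {e : G.E // G.s e = v} × Fin 2, K.r (.inr p) = .inl ⟨G.r f₀, hr⟩ := by
    rintro ⟨⟨e, he⟩, i⟩
    obtain rfl := honly e he
    simp only [K, inSplit]
    rw [dif_neg hr]
  have hKs : ∀ e, K.s (.inl e) = .inl ⟨G.s e.1, e.2⟩ := fun e => rfl
  have hK : MoveEquiv G K := MoveEquiv.moveI hfin v hreg (fun h => h e₀ he₀) 2 P hsurj
    ⟨⟨Equiv.refl _, Equiv.refl _, fun _ => rfl, fun _ => rfl⟩⟩
  have hKfin : Finite K.V := inferInstanceAs (Finite ({w : G.V // w ≠ v} ⊕ Fin 2))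
  let u : K.V := .inr 0
  let f : K.E := .inr (⟨f₀, hf⟩, 0)
  have hu : ∀ e : {e : G.E // G.s e ≠ v}, K.r (.inl e) = u ↔ G.r e.1 = v ∧ G.s e.1 = a := by
    intro e
    by_cases h : G.r e.1 = v
    · rw [hKr_pos e h, ← hP ⟨e.1, h⟩, and_iff_right h]
      exact Sum.inr_injective.eq_iff
    · rw [hKr_neg e h]
      exact iff_of_false Sum.inl_ne_inr fun h' => h h'.1
  have hu' : ∀ p, K.r (.inr p) ≠ u := fun p => by rw [hKr']; exact Sum.inl_ne_inr
  have hKonly : ∀ e, K.s e = u → e = f := by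
    rintro (e | ⟨⟨e, he⟩, i⟩) h
    · exact absurd h Sum.inl_ne_inr
    · obtain rfl := honly e he
      obtain rfl : i = 0 := Sum.inr_injective h
      rfl
  have hav : a ≠ v := he₀a ▸ hns e₀ he₀
  have hin : ∀ e, K.r e = u → K.s e = .inl ⟨a, hav⟩ := by
    rintro (e | p) h
    · rw [hKs]
      exact congrArg Sum.inl (Subtype.ext ((hu e).1 h).2)
    · exact absurd h (hu' p)
  let p : (K.reduce u f rfl (hu' _) hKonly _ hin).V → G.V := fun w =>
    Sum.elim Subtype.val (fun _ : Fin 2 => v) w.1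
  let q₀ : K.E → G.E := Sum.elim Subtype.val fun x => x.1.1
  let q : (K.reduce u f rfl (hu' _) hKonly _ hin).E → G.E :=
    Sum.elim (fun e => q₀ e.1) (fun e => q₀ e.1)
  refine hK.trans (MoveEquiv.moveR hKfin u f rfl (hu' _) hKonly _ hin
    ⟨(Iso.ofBijective (G := K.reduce u f rfl (hu' _) hKonly _ hin)
      (H := G.redirect {e | G.r e = v ∧ G.s e = a} (G.r f₀)) p q ⟨?_, ?_⟩ ⟨?_, ?_⟩ ?_ ?_).symm⟩)
  · have hone : ∀ i : Fin 2, (Sum.inr i : K.V) ≠ u → i = 1 := by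
      intro i hi
      have : i ≠ 0 := fun h => hi (congrArg Sum.inr h)
      omega
    rintro ⟨w | i, hw⟩ ⟨w' | i', hw'⟩ h
    · obtain rfl : w = w' := Subtype.ext h
      rfl
    · exact absurd h w.2
    · exact absurd h.symm w'.2
    · obtain rfl := hone i hw
      obtain rfl := hone i' hw'
      rfl
  · intro w
    by_cases h : w = v
    · exact ⟨⟨.inr 1, fun h => one_ne_zero (Sum.inr_injective h)⟩, h.symm⟩
    · exact ⟨⟨.inl ⟨w, h⟩, Sum.inl_ne_inr⟩, rfl⟩
  · have hone : ∀ i : Fin 2, (Sum.inr (⟨f₀, hf⟩, i) : K.E) ≠ f → i = 1 := by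
      intro i hi
      have : i ≠ 0 := by
        rintro rfl
        exact hi rfl
      omega
    have hq₀ : ∀ e e' : K.E, e ≠ f → e' ≠ f → q₀ e = q₀ e' → e = e' := by
      rintro (e | ⟨⟨e, he⟩, i⟩) (e' | ⟨⟨e', he'⟩, i'⟩) h h' heq
      · exact congrArg Sum.inl (Subtype.ext heq)
      · exact absurd ((congrArg G.s heq).trans he') e.2
      · exact absurd ((congrArg G.s heq).symm.trans he) e'.2
      · obtain rfl := honly e he
        obtain rfl := honly e' he'
        rw [hone i h, hone i' h']
    have hne : ∀ e : {e : K.E // K.r e = u}, e.1 ≠ f := fun e h => hu' _ (h ▸ e.2)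
    rintro (e | e) (e' | e') h
    · exact congrArg Sum.inl (Subtype.ext (hq₀ _ _ e.2.2 e'.2.2 h))
    · exact absurd (hq₀ _ _ e.2.2 (hne e') h ▸ e'.2) e.2.1
    · exact absurd (hq₀ _ _ (hne e) e'.2.2 h ▸ e.2) e'.2.1
    · exact congrArg Sum.inr (Subtype.ext (hq₀ _ _ (hne e) (hne e') h))
  · intro e
    by_cases h : G.s e = v
    · refine ⟨.inl ⟨.inr (⟨e, h⟩, 1), hu' _, fun h' => ?_⟩, rfl⟩
      exact one_ne_zero (congrArg Prod.snd (Sum.inr_injective h'))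
    · by_cases h' : K.r (.inl ⟨e, h⟩) = u
      · exact ⟨.inr ⟨_, h'⟩, rfl⟩
      · exact ⟨.inl ⟨_, h', Sum.inl_ne_inr⟩, rfl⟩
  · rintro (⟨e | ⟨⟨e, he⟩, i⟩, h⟩ | ⟨e | x, h⟩)
    · have hmem : e.1 ∉ {e | G.r e = v ∧ G.s e = a} := fun h' => h.1 ((hu e).2 h')
      refine (redirect_r_of_notMem G _ hmem).trans ?_
      change _ = Sum.elim Subtype.val (fun _ : Fin 2 => v) (K.r (.inl e))
      by_cases h' : G.r e.1 = v
      · rw [hKr_pos e h']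
        exact h'
      · rw [hKr_neg e h']
        rfl
    · obtain rfl := honly e he
      have hmem : e ∉ {e | G.r e = v ∧ G.s e = a} := fun h' => hr h'.1
      refine (redirect_r_of_notMem G _ hmem).trans ?_
      change _ = Sum.elim Subtype.val (fun _ : Fin 2 => v) (K.r (.inr _))
      rw [hKr']
      rfl
    · refine (redirect_r_of_mem G _ (A := {e | G.r e = v ∧ G.s e = a}) ((hu e).1 h)).trans ?_
      change _ = Sum.elim Subtype.val (fun _ : Fin 2 => v) (K.r f)
      rw [hKr']
      rfl
    · exact absurd h (hu' x)
  · rintro (⟨e | ⟨⟨e, he⟩, i⟩, h⟩ | ⟨e | x, h⟩)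
    · rfl
    · exact he
    · rfl
    · exact absurd h (hu' x)

/-- Redirecting along `f₀` all edges into `v` which come from a given vertex preserves
move-equivalence. -/
theorem moveEquiv_redirect_source (G : CKGraph) (hfin : Finite G.V) (v : G.V) (f₀ : G.E)
    (hf : G.s f₀ = v) (honly : ∀ e, G.s e = v → e = f₀) (hr : G.r f₀ ≠ v) (a : G.V) :
    MoveEquiv G (G.redirect {e | G.r e = v ∧ G.s e = a} (G.r f₀)) := by
  by_cases hex : ∃ e, G.r e = v ∧ G.s e = a
  · by_cases hex' : ∃ e, G.r e = v ∧ G.s e ≠ a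
    · exact G.moveEquiv_redirect_of_split hfin v f₀ hf honly hr a hex hex'
    · push Not at hex'
      have hA : {e | G.r e = v ∧ G.s e = a} = {e | G.r e = v} :=
        Set.ext fun e => and_iff_left_of_imp (hex' e)
      rw [hA]
      exact (G.moveEquiv_collapseOne_of_forall_source_eq hfin v f₀ hf honly hr a hex').trans
        (G.moveEquiv_redirect_collapseOne hfin v f₀ hf honly hr).symm
  · exact MoveEquiv.of_iso hfin ⟨⟨Equiv.refl _, Equiv.refl _,
      fun e => redirect_r_of_notMem G _ fun h => hex ⟨e, h⟩, fun _ => rfl⟩⟩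

/-- Redirecting along `f₀` all edges into `v` which come from a given finite set of vertices
preserves move-equivalence. -/
theorem moveEquiv_redirect_finset (G : CKGraph) (hfin : Finite G.V) (v : G.V) (f₀ : G.E)
    (hf : G.s f₀ = v) (honly : ∀ e, G.s e = v → e = f₀) (hr : G.r f₀ ≠ v) (S : Finset G.V) :
    MoveEquiv G (G.redirect {e | G.r e = v ∧ G.s e ∈ S} (G.r f₀)) := by
  classical
  induction S using Finset.induction_on with
  | empty =>
    exact MoveEquiv.of_iso hfin ⟨⟨Equiv.refl _, Equiv.refl _,
      fun e => redirect_r_of_notMem G _ fun h => Finset.notMem_empty _ h.2, fun _ => rfl⟩⟩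
  | insert a S _ ih =>
    let H := G.redirect {e | G.r e = v ∧ G.s e ∈ S} (G.r f₀)
    have hHr : H.r f₀ = G.r f₀ := redirect_r_of_notMem G _ fun h => hr h.1
    have hstep := H.moveEquiv_redirect_source hfin v f₀ hf honly (hHr ▸ hr) a
    refine ih.trans (hstep.trans (MoveEquiv.of_iso hfin
      ⟨⟨Equiv.refl _, Equiv.refl _, fun e => ?_, fun _ => rfl⟩⟩))
    change (G.redirect {e | G.r e = v ∧ G.s e ∈ insert a S} (G.r f₀)).r e =
      (H.redirect {e | H.r e = v ∧ G.s e = a} (H.r f₀)).r e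
    rw [hHr]
    simp only [H, redirect, Set.mem_ofPred_eq, Finset.mem_insert]
    split_ifs <;> grind

end CKGraph

/-- collapsing a regular non-source vertex that emits exactly one edge,
which is not a loop of length one, preserves move-equivalence. -/
theorem stmt0 (G : CKGraph) (hfin : Finite G.V) (v : G.V) (f₀ : G.E)
    (hreg : G.Regular v) (hnsrc : ¬ G.IsSource v)
    (hf : G.s f₀ = v) (honly : ∀ e, G.s e = v → e = f₀) (hr : G.r f₀ ≠ v) :
    CKGraph.MoveEquiv G (G.collapseOne v f₀ hf honly hr) := by
  have : Fintype G.V := Fintype.ofFinite G.V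
  have h := G.moveEquiv_redirect_finset hfin v f₀ hf honly hr Finset.univ
  simp only [Finset.mem_univ, and_true] at h
  exact h.trans (G.moveEquiv_redirect_collapseOne hfin v f₀ hf honly hr)
end

section
/- (Move (T).) Let G be a graph with finitely many vertices and let α = α₁α₂⋯αₙ be a path in G such that there are infinitely many edges from s(α₁) to r(α₁). Let E be the graph with the same vertex set as G obtained by adding to G countably infinitely many new edges, each with source s(α) and range r(α). Then G ∼_M E. -/
namespace CKGraph

theorem addEdges_iso_self (G : CKGraph) (u w : G.V)
    (hinf : {e : G.E | G.s e = u ∧ G.r e = w}.Infinite) :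
    Nonempty (Iso G (G.addEdges u w)) := by
  classical
  have : Infinite {e : G.E // G.s e = u ∧ G.r e = w} := hinf.to_subtype
  obtain ⟨φ⟩ : Nonempty ({e : G.E // G.s e = u ∧ G.r e = w} ≃
      {e : G.E // G.s e = u ∧ G.r e = w} ⊕ ℕ) := by
    rw [← Cardinal.eq, Cardinal.mk_sum]
    simp [Cardinal.add_eq_left (Cardinal.aleph0_le_mk _) (Cardinal.aleph0_le_mk _)]
  let S : G.E → Prop := fun e => G.s e = u ∧ G.r e = w
  let ψ : {e // S e} ≃ {e // S e} ⊕ ℕ := φ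
  let c := Equiv.sumCompl S
  let χ : {e // S e} ⊕ {e // ¬ S e} ≃ G.E ⊕ ℕ :=
    (Equiv.sumCongr ψ (Equiv.refl _)).trans <| (Equiv.sumAssoc _ _ _).trans <|
      (Equiv.sumCongr (Equiv.refl _) (Equiv.sumComm _ _)).trans <|
        (Equiv.sumAssoc _ _ _).symm.trans <| Equiv.sumCongr c (Equiv.refl ℕ)
  have key : ∀ x, (G.addEdges u w).r (χ x) = G.r (c x) ∧
      (G.addEdges u w).s (χ x) = G.s (c x) := by
    rintro (x | x)
    · have hx := x.2
      rcases h : ψ x with y | k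
      · have hy := y.2
        simp only [χ, c, addEdges, Equiv.trans_apply, Equiv.sumCongr_apply, Sum.map_inl, h,
          Equiv.sumAssoc_apply_inl_inl, Equiv.sumAssoc_symm_apply_inl, Equiv.refl_apply,
          Equiv.sumCompl_apply_inl]
        exact ⟨hy.2.trans hx.2.symm, hy.1.trans hx.1.symm⟩
      · simp only [χ, c, addEdges, Equiv.trans_apply, Equiv.sumCongr_apply, Sum.map_inl, h,
          Equiv.sumAssoc_apply_inl_inr, Equiv.sumAssoc_symm_apply_inr_inr, Equiv.refl_apply,
          Equiv.sumCompl_apply_inl, Sum.map_inr, Equiv.sumComm_apply, Sum.swap_inl]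
        exact ⟨hx.2.symm, hx.1.symm⟩
    · exact ⟨rfl, rfl⟩
  refine ⟨⟨Equiv.refl _, c.symm.trans χ, fun e => ?_, fun e => ?_⟩⟩
  · exact (key (c.symm e)).1.trans (congrArg G.r (c.apply_symm_apply e))
  · exact (key (c.symm e)).2.trans (congrArg G.s (c.apply_symm_apply e))

theorem addEdges_comm (G : CKGraph) (a b c d : G.V) :
    Nonempty (Iso ((G.addEdges a b).addEdges c d) ((G.addEdges c d).addEdges a b)) := by
  refine ⟨⟨Equiv.refl _, (Equiv.sumAssoc G.E ℕ ℕ).trans <|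
    (Equiv.sumCongr (Equiv.refl _) (Equiv.sumComm _ _)).trans (Equiv.sumAssoc _ _ _).symm,
    ?_, ?_⟩⟩ <;> rintro ((e | k) | k) <;> rfl

/-- Move (T) along `u → v → r f` when `v` emits only `f` and receives only from `u`. -/
theorem moveEquiv_addEdges_of_reduce (G : CKGraph) (hfin : Finite G.V) (u v : G.V) (f : G.E)
    (hf : G.s f = v) (hrf : G.r f ≠ v) (honly : ∀ e, G.s e = v → e = f)
    (hin : ∀ e, G.r e = v → G.s e = u)
    (hinf : {e : G.E | G.s e = u ∧ G.r e = v}.Infinite) :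
    MoveEquiv G (G.addEdges u (G.r f)) := by
  obtain ⟨e₀, he₀⟩ := hinf.nonempty
  have huv : u ≠ v := by
    intro h
    have := honly e₀ (he₀.1.trans h)
    exact hrf (this ▸ he₀.2)
  let R := G.reduce v f hf hrf honly u hin
  have hR : MoveEquiv G R := .moveR hfin v f hf hrf honly u hin ⟨⟨.refl _, .refl _,
    fun _ => rfl, fun _ => rfl⟩⟩
  have hRfin : Finite R.V := inferInstanceAs (Finite {w : G.V // w ≠ v})
  have hRR : MoveEquiv R (R.addEdges ⟨u, huv⟩ ⟨G.r f, hrf⟩) := by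
    refine .of_iso hRfin (addEdges_iso_self _ _ _ ?_)
    have : Infinite {e : G.E // G.s e = u ∧ G.r e = v} := hinf.to_subtype
    refine Set.infinite_of_injective_forall_mem
      (f := fun e : {e : G.E // G.s e = u ∧ G.r e = v} => (Sum.inr ⟨e.1, e.2.2⟩ : R.E)) ?_ ?_
    · intro a b h
      have h' := Sum.inr.inj h
      exact Subtype.ext (congrArg (fun x => x.1) h')
    · intro e
      exact ⟨Subtype.ext e.2.1, rfl⟩
  refine hR.trans (hRR.trans (MoveEquiv.symm ?_))
  refine .moveR (G := G.addEdges u (G.r f)) hfin v (.inl f) hf hrf ?_ u ?_ ⟨?_⟩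
  · rintro (e | k) h
    · exact congrArg _ (honly e h)
    · exact absurd h huv
  · rintro (e | k) h
    · exact hin e h
    · rfl
  · refine ⟨.refl _, ⟨?_, ?_, ?_, ?_⟩, ?_, ?_⟩
    · exact fun
        | .inl (.inl e) => .inl ⟨.inl e.1, e.2.1, fun h => e.2.2 (Sum.inl_injective h)⟩
        | .inl (.inr e) => .inr ⟨.inl e.1, e.2⟩
        | .inr k => .inl ⟨.inr k, hrf, Sum.inr_ne_inl⟩
    · exact fun
        | .inl ⟨.inl e, h⟩ => .inl (.inl ⟨e, h.1, fun h' => h.2 (congrArg _ h')⟩)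
        | .inl ⟨.inr k, _⟩ => .inr k
        | .inr ⟨.inl e, h⟩ => .inl (.inr ⟨e, h⟩)
        | .inr ⟨.inr _, h⟩ => absurd h hrf
    · rintro ((e | e) | k) <;> rfl
    · rintro (⟨e | k, h⟩ | ⟨e | k, h⟩)
      · rfl
      · rfl
      · rfl
      · exact absurd h hrf
    · rintro ((e | e) | k) <;> rfl
    · rintro ((e | e) | k) <;> rfl

/-- In-splitting commutes with adding edges that avoid the split vertex. -/
theorem inSplit_addEdges (G : CKGraph) (u w v : G.V) (hu : u ≠ v) (hw : w ≠ v) (n : ℕ)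
    (P : {e : G.E // G.r e = v} → Fin n)
    (P' : {e : (G.addEdges u w).E // (G.addEdges u w).r e = v} → Fin n)
    (hP : ∀ e h, P' ⟨.inl e, h⟩ = P ⟨e, h⟩) :
    Nonempty (Iso ((G.inSplit v n P).addEdges (.inl ⟨u, hu⟩) (.inl ⟨w, hw⟩))
      ((G.addEdges u w).inSplit v n P')) := by
  refine ⟨⟨.refl _, ⟨?_, ?_, ?_, ?_⟩, ?_, ?_⟩⟩
  · exact fun
      | .inl (.inl e) => .inl ⟨.inl e.1, e.2⟩
      | .inl (.inr e) => .inr (⟨.inl e.1.1, e.1.2⟩, e.2)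
      | .inr k => .inl ⟨.inr k, hu⟩
  · exact fun
      | .inl ⟨.inl e, h⟩ => .inl (.inl ⟨e, h⟩)
      | .inl ⟨.inr k, _⟩ => .inr k
      | .inr (⟨.inl e, h⟩, i) => .inl (.inr (⟨e, h⟩, i))
      | .inr (⟨.inr _, h⟩, _) => absurd h hu
  · rintro ((e | e) | k) <;> rfl
  · rintro (⟨e | k, h⟩ | ⟨⟨e | k, h⟩, i⟩)
    · rfl
    · rfl
    · rfl
    · exact absurd h hu
  · rintro ((e | ⟨e, i⟩) | k)
    · by_cases h : G.r e.1 = v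
      · exact (dif_pos h).trans ((congrArg Sum.inr (hP e.1 h)).trans
          (show (G.inSplit v n P).r (.inl e) = _ from dif_pos h).symm)
      · exact (dif_neg h).trans (show (G.inSplit v n P).r (.inl e) = _ from dif_neg h).symm
    · by_cases h : G.r e.1 = v
      · exact (dif_pos h).trans ((congrArg Sum.inr (hP e.1 h)).trans
          (show (G.inSplit v n P).r (.inr (e, i)) = _ from dif_pos h).symm)
      · exact (dif_neg h).trans (show (G.inSplit v n P).r (.inr (e, i)) = _ from dif_neg h).symm
    · exact dif_neg hw
  · rintro ((e | ⟨e, i⟩) | k) <;> rfl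

/-- Out-splitting commutes with adding edges whose range is not the split vertex. -/
theorem outSplit_addEdges (G : CKGraph) (u w v : G.V) (hw : w ≠ v) (n : ℕ)
    (P : {e : G.E // G.s e = v} → Fin n)
    (P' : {e : (G.addEdges u w).E // (G.addEdges u w).s e = v} → Fin n)
    (hP : ∀ e h, P' ⟨.inl e, h⟩ = P ⟨e, h⟩) (u' : (G.outSplit v n P).V)
    (hu : ∀ h : u ≠ v, u' = .inl ⟨u, h⟩) (hu' : ∀ k h, u' = .inr (P' ⟨.inr k, h⟩)) :
    Nonempty (Iso ((G.outSplit v n P).addEdges u' (.inl ⟨w, hw⟩))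
      ((G.addEdges u w).outSplit v n P')) := by
  refine ⟨⟨.refl _, ⟨?_, ?_, ?_, ?_⟩, ?_, ?_⟩⟩
  · exact fun
      | .inl (.inl e) => .inl ⟨.inl e.1, e.2⟩
      | .inl (.inr e) => .inr (⟨.inl e.1.1, e.1.2⟩, e.2)
      | .inr k => .inl ⟨.inr k, hw⟩
  · exact fun
      | .inl ⟨.inl e, h⟩ => .inl (.inl ⟨e, h⟩)
      | .inl ⟨.inr k, _⟩ => .inr k
      | .inr (⟨.inl e, h⟩, i) => .inl (.inr (⟨e, h⟩, i))
      | .inr (⟨.inr _, h⟩, _) => absurd h hw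
  · rintro ((e | e) | k) <;> rfl
  · rintro (⟨e | k, h⟩ | ⟨⟨e | k, h⟩, i⟩)
    · rfl
    · rfl
    · rfl
    · exact absurd h hw
  · rintro ((e | ⟨e, i⟩) | k) <;> rfl
  · rintro ((e | ⟨e, i⟩) | k)
    · by_cases h : G.s e.1 = v
      · exact (dif_pos h).trans ((congrArg Sum.inr (hP e.1 h)).trans
          (show (G.outSplit v n P).s (.inl e) = _ from dif_pos h).symm)
      · exact (dif_neg h).trans (show (G.outSplit v n P).s (.inl e) = _ from dif_neg h).symm
    · by_cases h : G.s e.1 = v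
      · exact (dif_pos h).trans ((congrArg Sum.inr (hP e.1 h)).trans
          (show (G.outSplit v n P).s (.inr (e, i)) = _ from dif_pos h).symm)
      · exact (dif_neg h).trans (show (G.outSplit v n P).s (.inr (e, i)) = _ from dif_neg h).symm
    · by_cases h : u = v
      · exact (dif_pos h).trans (hu' k h).symm
      · exact (dif_neg h).trans (hu h).symm

/-- Move (T) along `u → v → r f` when `v` emits only `f`. -/
theorem moveEquiv_addEdges_of_emits_one (G : CKGraph) (hfin : Finite G.V) (u v : G.V) (f : G.E)
    (hf : G.s f = v) (hrf : G.r f ≠ v) (honly : ∀ e, G.s e = v → e = f)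
    (hinf : {e : G.E | G.s e = u ∧ G.r e = v}.Infinite) :
    MoveEquiv G (G.addEdges u (G.r f)) := by
  classical
  by_cases hin : ∀ e, G.r e = v → G.s e = u
  · exact moveEquiv_addEdges_of_reduce G hfin u v f hf hrf honly hin hinf
  push Not at hin
  obtain ⟨e₁, he₁, he₁u⟩ := hin
  obtain ⟨e₀, he₀, he₀v⟩ := hinf.nonempty
  have huv : u ≠ v := by
    intro h
    have := honly e₀ (he₀.trans h)
    exact hrf (this ▸ he₀v)
  let P : {e : G.E // G.r e = v} → Fin 2 := fun e => if G.s e.1 = u then 0 else 1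
  let P' : {e : (G.addEdges u (G.r f)).E // (G.addEdges u (G.r f)).r e = v} → Fin 2 :=
    fun e => if (G.addEdges u (G.r f)).s e.1 = u then 0 else 1
  have hsing : {e | G.s e = v} ⊆ {f} := fun e he => honly e he
  have h₁ : MoveEquiv G (G.inSplit v 2 P) := by
    refine .moveI hfin v ⟨⟨f, hf⟩, (Set.finite_singleton f).subset hsing⟩
      (fun h => h e₀ he₀v) 2 P ?_ ⟨⟨.refl _, .refl _, fun _ => rfl, fun _ => rfl⟩⟩
    intro i
    fin_cases i
    · exact ⟨⟨e₀, he₀v⟩, if_pos he₀⟩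
    · exact ⟨⟨e₁, he₁⟩, if_neg he₁u⟩
  have h₂ : MoveEquiv (G.addEdges u (G.r f)) ((G.addEdges u (G.r f)).inSplit v 2 P') := by
    refine .moveI (G := G.addEdges u (G.r f)) hfin v ⟨⟨.inl f, hf⟩, (Set.finite_singleton (Sum.inl f)).subset ?_⟩
      (fun h => h (.inl e₀) he₀v) 2 P' ?_ ⟨⟨.refl _, .refl _, fun _ => rfl, fun _ => rfl⟩⟩
    · rintro (e | k) he
      · exact congrArg Sum.inl (honly e he)
      · exact absurd he huv
    · intro i
      fin_cases i
      · exact ⟨⟨.inl e₀, he₀v⟩, if_pos he₀⟩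
      · exact ⟨⟨.inl e₁, he₁⟩, if_neg he₁u⟩
  have hIfin : Finite (G.inSplit v 2 P).V :=
    inferInstanceAs (Finite ({w : G.V // w ≠ v} ⊕ Fin 2))
  have h₃ : MoveEquiv (G.inSplit v 2 P)
      ((G.inSplit v 2 P).addEdges (.inl ⟨u, huv⟩) (.inl ⟨G.r f, hrf⟩)) := by
    have hr : (G.inSplit v 2 P).r (.inr (⟨f, hf⟩, 0)) = .inl ⟨G.r f, hrf⟩ := dif_neg hrf
    rw [← hr]
    refine moveEquiv_addEdges_of_reduce _ hIfin _ (.inr 0) _ rfl ?_ ?_ ?_ ?_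
    · rw [hr]
      exact Sum.inl_ne_inr
    · rintro (e | ⟨⟨e, he⟩, i⟩) h
      · exact absurd h Sum.inl_ne_inr
      · obtain rfl := honly e he
        obtain rfl : i = 0 := Sum.inr_injective h
        rfl
    · rintro (e | ⟨⟨e, he⟩, i⟩) h
      · by_cases hv : G.r e.1 = v
        · by_cases hu : G.s e.1 = u
          · exact congrArg Sum.inl (Subtype.ext hu)
          · simp [inSplit, hv, P, hu] at h
        · simp [inSplit, hv] at h
      · obtain rfl := honly e he
        simp [inSplit, hrf] at h
    · have : Infinite {e : G.E // G.s e = u ∧ G.r e = v} := hinf.to_subtype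
      refine Set.infinite_of_injective_forall_mem
        (f := fun e : {e : G.E // G.s e = u ∧ G.r e = v} =>
          (Sum.inl ⟨e.1, fun h => huv (e.2.1.symm.trans h)⟩ : (G.inSplit v 2 P).E)) ?_ ?_
      · intro a b h
        have h' := Sum.inl.inj h
        exact Subtype.ext (congrArg (fun x => x.1) h')
      · rintro ⟨e, hu, hv⟩
        exact ⟨congrArg Sum.inl (Subtype.ext hu), by simp [inSplit, hv, P, hu]⟩
  refine h₁.trans (h₃.trans (.trans (.of_iso hIfin ?_) h₂.symm))
  exact inSplit_addEdges G u (G.r f) v huv hrf 2 P P' fun _ _ => rfl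

/-- Move (T) along the path `u → s f → r f`. -/
theorem moveEquiv_addEdges_of_edge (G : CKGraph) (hfin : Finite G.V) (u : G.V) (f : G.E)
    (hinf : {e : G.E | G.s e = u ∧ G.r e = G.s f}.Infinite) :
    MoveEquiv G (G.addEdges u (G.r f)) := by
  classical
  by_cases hrf : G.r f = G.s f
  · exact .of_iso hfin (addEdges_iso_self _ _ _ (hrf ▸ hinf))
  by_cases honly : ∀ e, G.s e = G.s f → e = f
  · exact moveEquiv_addEdges_of_emits_one G hfin u (G.s f) f rfl hrf honly hinf
  push Not at honly
  obtain ⟨g, hg, hgf⟩ := honly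
  let P : {e : G.E // G.s e = G.s f} → Fin 2 := fun e => if e.1 = f then 0 else 1
  let P' : {e : (G.addEdges u (G.r f)).E // (G.addEdges u (G.r f)).s e = G.s f} → Fin 2 :=
    fun e => if e.1 = .inl f then 0 else 1
  have h₁ : MoveEquiv G (G.outSplit (G.s f) 2 P) := by
    refine .moveO hfin (G.s f) (fun h => h f rfl) 2 P ?_ ?_
      ⟨⟨.refl _, .refl _, fun _ => rfl, fun _ => rfl⟩⟩
    · intro i
      fin_cases i
      · exact ⟨⟨f, rfl⟩, if_pos rfl⟩
      · exact ⟨⟨g, hg⟩, if_neg hgf⟩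
    · have h0 : ∀ i, {x | P x = i}.Infinite → i = 1 := by
        intro i hi
        by_contra h
        obtain rfl : i = 0 := by omega
        refine hi ((Set.finite_singleton ⟨f, rfl⟩).subset fun x hx => Subtype.ext ?_)
        by_contra hne
        exact one_ne_zero ((if_neg hne).symm.trans hx)
      exact fun i j hi hj => (h0 i hi).trans (h0 j hj).symm
  have h₂ : MoveEquiv (G.addEdges u (G.r f))
      ((G.addEdges u (G.r f)).outSplit (G.s f) 2 P') := by
    refine .moveO (G := G.addEdges u (G.r f)) hfin (G.s f) (fun h => h (.inl f) rfl) 2 P' ?_ ?_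
      ⟨⟨.refl _, .refl _, fun _ => rfl, fun _ => rfl⟩⟩
    · intro i
      fin_cases i
      · exact ⟨⟨.inl f, rfl⟩, if_pos rfl⟩
      · exact ⟨⟨.inl g, hg⟩, if_neg fun h => hgf (Sum.inl_injective h)⟩
    · have h0 : ∀ i, {x | P' x = i}.Infinite → i = 1 := by
        intro i hi
        by_contra h
        obtain rfl : i = 0 := by omega
        refine hi ((Set.finite_singleton ⟨.inl f, rfl⟩).subset fun x hx => Subtype.ext ?_)
        by_contra hne
        exact one_ne_zero ((if_neg hne).symm.trans hx)
      exact fun i j hi hj => (h0 i hi).trans (h0 j hj).symm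
  have hOfin : Finite (G.outSplit (G.s f) 2 P).V :=
    inferInstanceAs (Finite ({w : G.V // w ≠ G.s f} ⊕ Fin 2))
  let u' : (G.outSplit (G.s f) 2 P).V :=
    if h : u = G.s f then .inr 1 else .inl ⟨u, h⟩
  have h₃ : MoveEquiv (G.outSplit (G.s f) 2 P)
      ((G.outSplit (G.s f) 2 P).addEdges u' (.inl ⟨G.r f, hrf⟩)) := by
    refine moveEquiv_addEdges_of_emits_one _ hOfin u' (.inr 0) (.inl ⟨f, hrf⟩) ?_ ?_ ?_ ?_
    · simp [outSplit, P]
    · exact Sum.inl_ne_inr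
    · rintro (⟨e, he⟩ | ⟨⟨e, he⟩, i⟩) h
      · by_cases hv : G.s e = G.s f
        · by_cases hef : e = f
          · subst hef
            rfl
          · simp [outSplit, P, hv, hef] at h
        · simp [outSplit, hv] at h
      · by_cases hv : G.s e = G.s f
        · by_cases hef : e = f
          · exact absurd (hef ▸ he) hrf
          · simp [outSplit, P, hv, hef] at h
        · simp [outSplit, hv] at h
    · have : Infinite {e : G.E // G.s e = u ∧ G.r e = G.s f} := hinf.to_subtype
      refine Set.infinite_of_injective_forall_mem
        (f := fun e : {e : G.E // G.s e = u ∧ G.r e = G.s f} =>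
          (Sum.inr (⟨e.1, e.2.2⟩, 0) : (G.outSplit (G.s f) 2 P).E)) ?_ ?_
      · intro a b h
        exact Subtype.ext (congrArg (fun x => x.1.1) (Sum.inr.inj h))
      · rintro ⟨e, rfl, hv⟩
        have hef : e ≠ f := fun h => hrf (h ▸ hv)
        refine ⟨?_, rfl⟩
        by_cases h : G.s e = G.s f <;> simp [outSplit, P, u', h, hef]
  refine h₁.trans (h₃.trans (.trans (.of_iso hOfin ?_) h₂.symm))
  refine outSplit_addEdges G u (G.r f) (G.s f) hrf 2 P P' ?_ u' ?_ ?_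
  · intro e h
    exact if_congr Sum.inl_injective.eq_iff rfl rfl
  · intro h
    exact dif_neg h
  · intro k (h : u = G.s f)
    exact (dif_pos h).trans (congrArg Sum.inr (if_neg Sum.inr_ne_inl).symm)

theorem infinite_addEdges (G : CKGraph) (a b u v : G.V)
    (hinf : {e : G.E | G.s e = u ∧ G.r e = v}.Infinite) :
    {e : (G.addEdges a b).E | (G.addEdges a b).s e = u ∧ (G.addEdges a b).r e = v}.Infinite := by
  refine (hinf.image (f := Sum.inl) Sum.inl_injective.injOn).mono ?_
  rintro _ ⟨e, he, rfl⟩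
  exact he

theorem infinite_addEdges_self (G : CKGraph) (u v : G.V) :
    {e : (G.addEdges u v).E | (G.addEdges u v).s e = u ∧ (G.addEdges u v).r e = v}.Infinite :=
  Set.infinite_of_injective_forall_mem (f := fun k : ℕ => (Sum.inr k : (G.addEdges u v).E))
    Sum.inr_injective fun _ => ⟨rfl, rfl⟩

/-- Move (T) along an edge from `u` to `v`, with infinitely many parallel edges, followed by
a path from `v` to `w` in a subgraph `G` on the same vertices. -/
theorem HasPath.moveEquiv_addEdges {G : CKGraph} {v w : G.V} (h : G.HasPath v w)
    (hfin : Finite G.V) (u : G.V) (E : Type) (r s : E → G.V)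
    (hsub : ∀ e, ∃ e', s e' = G.s e ∧ r e' = G.r e)
    (hinf : {e : E | s e = u ∧ r e = v}.Infinite) :
    MoveEquiv ⟨G.V, E, r, s⟩ (addEdges ⟨G.V, E, r, s⟩ u w) := by
  induction h generalizing E with
  | single f =>
    obtain ⟨e', hs, hr⟩ := hsub f
    rw [← hs] at hinf
    have := moveEquiv_addEdges_of_edge ⟨G.V, E, r, s⟩ hfin u e' hinf
    rwa [show CKGraph.r ⟨G.V, E, r, s⟩ e' = G.r f from hr] at this
  | @cons f w _ ih =>
    obtain ⟨e', hs, hr⟩ := hsub f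
    rw [← hs] at hinf
    let H : CKGraph := ⟨G.V, E, r, s⟩
    have h₁ : MoveEquiv H (H.addEdges u (H.r e')) :=
      moveEquiv_addEdges_of_edge H hfin u e' hinf
    have h₂ : MoveEquiv (H.addEdges u w) ((H.addEdges u w).addEdges u (H.r e')) :=
      moveEquiv_addEdges_of_edge (H.addEdges u w) hfin u (.inl e')
        (infinite_addEdges H u w u _ hinf)
    have h₃ : MoveEquiv (H.addEdges u (H.r e')) ((H.addEdges u (H.r e')).addEdges u w) := by
      refine ih (H.addEdges u (H.r e')).E (H.addEdges u (H.r e')).r (H.addEdges u (H.r e')).s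
        (fun e => ?_) ?_
      · obtain ⟨e'', h⟩ := hsub e
        exact ⟨.inl e'', h⟩
      · have := infinite_addEdges_self H u (H.r e')
        rwa [show H.r e' = G.r f from hr] at this ⊢
    exact h₁.trans (h₃.trans (.trans (.of_iso hfin (addEdges_comm H _ _ _ _)) h₂.symm))

theorem IsPathFromTo.hasPath {G : CKGraph} {l : List G.E} {u w : G.V}
    (h : G.IsPathFromTo l u w) : G.HasPath u w := by
  induction l generalizing u with
  | nil => exact absurd rfl h.1
  | cons e t ih =>
    obtain ⟨hl, hc, rfl, rfl⟩ := h
    cases t with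
    | nil => exact .single e
    | cons e' t =>
      obtain ⟨h, hc⟩ := List.isChain_cons_cons.1 hc
      exact .cons e (ih ⟨List.cons_ne_nil _ _, hc, h.symm, by simp⟩)

end CKGraph

/-- Move (T): if `α` is a path in `G` whose first edge `α₁` is parallel
to infinitely many edges, then adding countably infinitely many edges from `s α` to
`r α` preserves move-equivalence. -/
theorem stmt2 (G : CKGraph) (hfin : Finite G.V) (l : List G.E) (u w : G.V)
    (hpath : G.IsPathFromTo l u w)
    (hinf : ∀ h : l ≠ [],
      {e : G.E | G.s e = G.s (l.head h) ∧ G.r e = G.r (l.head h)}.Infinite) :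
    CKGraph.MoveEquiv G (G.addEdges u w) := by
  obtain ⟨hl, hc, rfl, rfl⟩ := hpath
  specialize hinf hl
  cases l with
  | nil => exact absurd rfl hl
  | cons e t =>
    cases t with
    | nil => exact .of_iso hfin (CKGraph.addEdges_iso_self _ _ _ hinf)
    | cons e' t =>
      obtain ⟨h, hc⟩ := List.isChain_cons_cons.1 hc
      have hp : G.IsPathFromTo (e' :: t) (G.r e)
          (G.r ((e :: e' :: t).getLast hl)) :=
        ⟨List.cons_ne_nil _ _, hc, h.symm, by simp⟩
      exact hp.hasPath.moveEquiv_addEdges hfin _ G.E G.r G.s (fun e => ⟨e, rfl, rfl⟩) hinf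
end

section
/- Let G be a graph with finitely many vertices such that every vertex connects to a loop (for every vertex v there is a loop μ with v ≥ s(μ)) and such that the only hereditary saturated subsets of G⁰ are ∅ and G⁰ (these conditions hold whenever the graph C*-algebra C*(G) is unital and purely infinite simple). Then G ∼_M E for some graph E with finitely many vertices, no sinks, and no sources. -/
namespace CKGraph

/-- The only hereditary saturated sets of vertices are the trivial ones. -/
def HasTrivialHereditarySaturatedSets (G : CKGraph) : Prop :=
  ∀ H : Set G.V, G.Hereditary H → G.Saturated H → H = ∅ ∨ H = Set.univ

theorem HasPath.not_isSink {G : CKGraph} {u v : G.V} (h : G.HasPath u v) : ¬ G.IsSink u := by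
  cases h with
  | single e => exact fun hs => hs e rfl
  | cons e _ => exact fun hs => hs e rfl

theorem not_isSink_of_geq {G : CKGraph} {u v : G.V} (h : G.Geq u v) (hv : ¬ G.IsSink v) :
    ¬ G.IsSink u := by
  rcases h with rfl | h
  · exact hv
  · exact h.not_isSink

theorem IsSource.hereditary_compl {G : CKGraph} {v : G.V} (hv : G.IsSource v) :
    G.Hereditary {v}ᶜ := fun e _ => hv e

/-- A source is regular in a graph without sinks and without nontrivial hereditary
saturated sets. -/
theorem IsSource.regular {G : CKGraph} {v : G.V} (hv : G.IsSource v) (hsink : ¬ G.IsSink v)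
    (hG : G.HasTrivialHereditarySaturatedSets) : G.Regular v := by
  by_contra hreg
  obtain ⟨e, -⟩ : ∃ e, G.s e = v := by simpa [IsSink] using hsink
  have hsat : G.Saturated {v}ᶜ := by
    rintro w hw - rfl
    exact hreg hw
  rcases hG _ hv.hereditary_compl hsat with h | h
  · have hmem : G.r e ∈ ({v}ᶜ : Set G.V) := hv e
    rw [h] at hmem
    exact hmem
  · have hmem : v ∈ ({v}ᶜ : Set G.V) := h ▸ Set.mem_univ v
    exact hmem rfl

theorem not_isSink_removeSource {G : CKGraph} {v : G.V} (hv : G.IsSource v)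
    (hsink : ∀ w, ¬ G.IsSink w) (w : (G.removeSource v hv).V) :
    ¬ (G.removeSource v hv).IsSink w := by
  intro hw
  refine hsink w.1 fun e he => hw ⟨e, fun h => w.2 (he.symm.trans h)⟩ ?_
  exact Subtype.ext he

theorem Regular.removeSource {G : CKGraph} {v : G.V} (hv : G.IsSource v)
    {w : G.V} (hw : G.Regular w) (hwv : w ≠ v) :
    (G.removeSource v hv).Regular ⟨w, hwv⟩ := by
  obtain ⟨⟨e, he⟩, hfin⟩ := hw
  refine ⟨⟨⟨e, fun h => hwv (he.symm.trans h)⟩, Subtype.ext he⟩, ?_⟩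
  refine (hfin.preimage (f := Subtype.val) Subtype.val_injective.injOn).subset ?_
  intro x hx
  exact congrArg Subtype.val hx

theorem HasTrivialHereditarySaturatedSets.removeSource {G : CKGraph} {v : G.V}
    (hv : G.IsSource v) (hG : G.HasTrivialHereditarySaturatedSets) :
    (G.removeSource v hv).HasTrivialHereditarySaturatedSets := by
  intro H hher hsat
  let K : Set G.V :=
    {w | (∃ h : w ≠ v, (⟨w, h⟩ : (G.removeSource v hv).V) ∈ H) ∨
      (w = v ∧ ∀ e, G.s e = v → (⟨G.r e, hv e⟩ : (G.removeSource v hv).V) ∈ H)}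
  have hK : ∀ {w : G.V} (h : w ≠ v), w ∈ K → (⟨w, h⟩ : (G.removeSource v hv).V) ∈ H := by
    rintro w h (⟨_, hw⟩ | ⟨hw, _⟩)
    · exact hw
    · exact absurd hw h
  have hKher : G.Hereditary K := by
    rintro e (⟨h, he⟩ | ⟨h, he⟩)
    · exact Or.inl ⟨hv e, hher ⟨e, h⟩ he⟩
    · exact Or.inl ⟨hv e, he e h⟩
  have hKsat : G.Saturated K := by
    intro w hw hr
    by_cases h : w = v
    · subst h
      exact Or.inr ⟨rfl, fun e he => hK _ (hr e he)⟩
    · refine Or.inl ⟨h, hsat _ (hw.removeSource hv h) fun e he => ?_⟩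
      exact hK (hv e.1) (hr e.1 (congrArg Subtype.val he))
  rcases hG K hKher hKsat with h | h
  · left
    refine Set.eq_empty_of_forall_notMem fun w hw => ?_
    have hmem : w.1 ∈ K := Or.inl ⟨w.2, hw⟩
    rw [h] at hmem
    exact hmem
  · exact Or.inr (Set.eq_univ_of_forall fun w => hK w.2 (h ▸ Set.mem_univ w.1))

/-- Repeatedly removing sources terminates in a graph without sinks and sources. -/
theorem exists_moveEquiv_no_sinks_no_sources (n : ℕ) (G : CKGraph) (hcard : Nat.card G.V = n)
    (hfin : Finite G.V) (hsink : ∀ v, ¬ G.IsSink v)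
    (hG : G.HasTrivialHereditarySaturatedSets) :
    ∃ E : CKGraph, Finite E.V ∧ (∀ v, ¬ E.IsSink v) ∧ (∀ v, ¬ E.IsSource v) ∧
      MoveEquiv G E := by
  induction n using Nat.strong_induction_on generalizing G with
  | _ n ih =>
    by_cases hsource : ∃ v, G.IsSource v
    · obtain ⟨v, hv⟩ := hsource
      have hfin' : Finite (G.removeSource v hv).V := Subtype.finite
      have hlt : Nat.card (G.removeSource v hv).V < n :=
        hcard ▸ Finite.card_subtype_lt (p := fun w => w ≠ v) (x := v) (fun h => h rfl)
      obtain ⟨E, hE, hEsink, hEsource, hGE⟩ := ih _ hlt _ rfl hfin'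
        (not_isSink_removeSource hv hsink) (hG.removeSource hv)
      refine ⟨E, hE, hEsink, hEsource, .trans (.moveS hfin v (hv.regular (hsink v) hG) hv ?_) hGE⟩
      exact ⟨⟨Equiv.refl _, Equiv.refl _, fun _ => rfl, fun _ => rfl⟩⟩
    · exact ⟨G, hfin, hsink, fun v hv => hsource ⟨v, hv⟩,
        .of_iso hfin ⟨⟨Equiv.refl _, Equiv.refl _, fun _ => rfl, fun _ => rfl⟩⟩⟩

end CKGraph

/-- a graph with finitely many vertices, in which every vertex connects
to a loop and whose only hereditary saturated vertex sets are trivial, is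
move-equivalent to a graph with finitely many vertices, no sinks and no sources. -/
theorem stmt3 (G : CKGraph) (hfin : Finite G.V)
    (hloop : ∀ v : G.V, ∃ w : G.V, G.HasPath w w ∧ G.Geq v w)
    (hsimple : ∀ H : Set G.V, G.Hereditary H → G.Saturated H → H = ∅ ∨ H = Set.univ) :
    ∃ E : CKGraph, Finite E.V ∧ (∀ v : E.V, ¬ E.IsSink v) ∧
      (∀ v : E.V, ¬ E.IsSource v) ∧ CKGraph.MoveEquiv G E := by
  refine CKGraph.exists_moveEquiv_no_sinks_no_sources _ G rfl hfin (fun v => ?_) hsimple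
  obtain ⟨w, hw, hvw⟩ := hloop v
  exact CKGraph.not_isSink_of_geq hvw hw.not_isSink
end

section
/- Let G be a graph with finitely many vertices, no sinks, and no sources (as holds for the graph of a simple unital graph C*-algebra). Then G ∼_M E for some graph E with no more vertices than G, no sinks, no sources, and in which every regular vertex supports a loop of length one. -/
namespace CKGraph

/-- The number of edges from `x` to `y`. -/
def adj (G : CKGraph) (x y : G.V) : Cardinal.{0} :=
  Cardinal.mk {e : G.E // G.s e = x ∧ G.r e = y}

/-- Graphs with the same edge multiplicities are isomorphic. -/
theorem nonempty_iso_of_adj {G H : CKGraph} (φ : G.V ≃ H.V)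
    (h : ∀ x y, H.adj (φ x) (φ y) = G.adj x y) : Nonempty (Iso G H) := by
  have hc : ∀ x y, Nonempty ({e : G.E // G.s e = x ∧ G.r e = y} ≃
      {e : H.E // H.s e = φ x ∧ H.r e = φ y}) :=
    fun x y => Cardinal.eq.1 (h x y).symm
  let c := fun x y => Classical.choice (hc x y)
  let F : G.E → H.E := fun e => (c (G.s e) (G.r e) ⟨e, rfl, rfl⟩).1
  have hF : ∀ x y (a : {e : G.E // G.s e = x ∧ G.r e = y}), F a.1 = (c x y a).1 := by
    rintro _ _ ⟨e, rfl, rfl⟩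
    rfl
  have hs : ∀ e, H.s (F e) = φ (G.s e) := fun e => (c (G.s e) (G.r e) ⟨e, rfl, rfl⟩).2.1
  have hr : ∀ e, H.r (F e) = φ (G.r e) := fun e => (c (G.s e) (G.r e) ⟨e, rfl, rfl⟩).2.2
  have hbij : Function.Bijective F := by
    constructor
    · intro e e' hee
      have h1 : G.s e' = G.s e := φ.injective (by rw [← hs, ← hs, hee])
      have h2 : G.r e' = G.r e := φ.injective (by rw [← hr, ← hr, hee])
      have h3 := hF _ _ ⟨e', h1, h2⟩
      have h4 := hF _ _ ⟨e, rfl, rfl⟩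
      have h5 := (c (G.s e) (G.r e)).injective
        (Subtype.ext (h4.symm.trans (hee.trans h3)))
      exact congrArg Subtype.val h5
    · intro e'
      have hx := φ.apply_symm_apply (H.s e')
      have hy := φ.apply_symm_apply (H.r e')
      refine ⟨((c (φ.symm (H.s e')) (φ.symm (H.r e'))).symm ⟨e', hx.symm, hy.symm⟩).1, ?_⟩
      exact (hF _ _ _).trans (congrArg Subtype.val (Equiv.apply_symm_apply _ _))
  exact ⟨⟨φ, Equiv.ofBijective F hbij, hr, hs⟩⟩

/-- `H` is, up to isomorphism, the result of collapsing the vertex `v` of `G`. -/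
def IsCollapse (G : CKGraph) (v : G.V) (H : CKGraph) : Prop :=
  ∃ φ : {w : G.V // w ≠ v} ≃ H.V, ∀ x y,
    H.adj (φ x) (φ y) = G.adj x y + G.adj x v * G.adj v y

/-- Two graphs obtained by collapsing the same vertex are isomorphic. -/
theorem IsCollapse.nonempty_iso {G H K : CKGraph} {v : G.V} (hH : IsCollapse G v H)
    (hK : IsCollapse G v K) : Nonempty (Iso H K) := by
  obtain ⟨φ, hφ⟩ := hH
  obtain ⟨ψ, hψ⟩ := hK
  refine nonempty_iso_of_adj (φ.symm.trans ψ) fun x y => ?_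
  obtain ⟨x, rfl⟩ := φ.surjective x
  obtain ⟨y, rfl⟩ := φ.surjective y
  simp [hφ, hψ]

theorem adj_collapse (G : CKGraph) (v : G.V) (hnl : ∀ e, G.s e = v → G.r e ≠ v)
    (x y : {w : G.V // w ≠ v}) :
    (G.collapse v hnl).adj x y = G.adj x y + G.adj x v * G.adj v y := by
  obtain ⟨x, hx⟩ := x
  obtain ⟨y, hy⟩ := y
  unfold adj
  rw [Cardinal.mul_def, Cardinal.add_def]
  refine Cardinal.mk_congr ⟨fun a => match a with
    | ⟨.inl e, h⟩ => .inl ⟨e.1, congrArg Subtype.val h.1, congrArg Subtype.val h.2⟩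
    | ⟨.inr p, h⟩ => .inr (⟨p.1.1, congrArg Subtype.val h.1, p.1.2⟩,
        ⟨p.2.1, p.2.2, congrArg Subtype.val h.2⟩), fun a => match a with
    | .inl e => ⟨.inl ⟨e.1, by rw [e.2.2]; exact hy, by rw [e.2.1]; exact hx⟩,
        Subtype.ext e.2.1, Subtype.ext e.2.2⟩
    | .inr p => ⟨.inr (⟨p.1.1, p.1.2.2⟩, ⟨p.2.1, p.2.2.1⟩), Subtype.ext p.1.2.1,
        Subtype.ext p.2.2.2⟩, ?_, ?_⟩
  · rintro ⟨_ | _, _⟩ <;> rfl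
  · rintro (_ | _) <;> rfl

theorem isCollapse_collapse (G : CKGraph) (v : G.V) (hnl : ∀ e, G.s e = v → G.r e ≠ v) :
    IsCollapse G v (G.collapse v hnl) :=
  ⟨Equiv.refl _, adj_collapse G v hnl⟩

theorem isCollapse_reduce (G : CKGraph) (u : G.V) (f : G.E) (hf : G.s f = u)
    (hrf : G.r f ≠ u) (honly : ∀ e, G.s e = u → e = f) (v : G.V)
    (hin : ∀ e, G.r e = u → G.s e = v) :
    IsCollapse G u (G.reduce u f hf hrf honly v hin) := by
  refine ⟨Equiv.refl _, fun x y => ?_⟩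
  obtain ⟨x, hx⟩ := x
  obtain ⟨y, hy⟩ := y
  unfold adj
  rw [Cardinal.mul_def, Cardinal.add_def]
  refine Cardinal.mk_congr ⟨fun a => match a with
    | ⟨.inl e, h⟩ => .inl ⟨e.1, congrArg Subtype.val h.1, congrArg Subtype.val h.2⟩
    | ⟨.inr e, h⟩ => .inr (⟨e.1, congrArg Subtype.val h.1, e.2⟩,
        ⟨f, hf, congrArg Subtype.val h.2⟩), fun a => match a with
    | .inl e => ⟨.inl ⟨e.1, by rw [e.2.2]; exact hy,
        fun h => hx (by rw [← hf, ← h]; exact e.2.1.symm)⟩,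
        Subtype.ext e.2.1, Subtype.ext e.2.2⟩
    | .inr p => ⟨.inr ⟨p.1.1, p.1.2.2⟩, Subtype.ext p.1.2.1,
        Subtype.ext (honly _ p.2.2.1 ▸ p.2.2.2)⟩, ?_, ?_⟩
  · rintro ⟨_ | _, _⟩ <;> rfl
  · rintro (_ | ⟨⟨e, he⟩, ⟨f', hf', hy'⟩⟩)
    · rfl
    · obtain rfl := honly f' hf'
      rfl

/-- If `K` arises from `G` by splitting the loopless vertex `v` in two, then collapsing
both copies of `v` one after the other amounts to collapsing `v`. -/
theorem IsCollapse.of_split {G K H : CKGraph} {v : G.V} (hH : IsCollapse G v H)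
    (ι : {w : G.V // w ≠ v} ⊕ Fin 2 ≃ K.V)
    (hnl : ∀ e, K.s e = ι (.inr 0) → K.r e ≠ ι (.inr 0))
    (hll : ∀ x y, K.adj (ι (.inl x)) (ι (.inl y)) = G.adj x y)
    (hrr : ∀ i j, K.adj (ι (.inr i)) (ι (.inr j)) = 0)
    (hlr : ∀ x y, K.adj (ι (.inl x)) (ι (.inr 0)) * K.adj (ι (.inr 0)) (ι (.inl y)) +
      K.adj (ι (.inl x)) (ι (.inr 1)) * K.adj (ι (.inr 1)) (ι (.inl y)) =
        G.adj x v * G.adj v y)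
    (h10 : ι (.inr 1) ≠ ι (.inr 0)) :
    IsCollapse (K.collapse (ι (.inr 0)) hnl) ⟨ι (.inr 1), h10⟩ H := by
  obtain ⟨φ, hφ⟩ := hH
  let L := K.collapse (ι (.inr 0)) hnl
  let v₁ : L.V := ⟨ι (.inr 1), h10⟩
  let θ : {w : G.V // w ≠ v} → {z : L.V // z ≠ v₁} := fun w =>
    ⟨⟨ι (.inl w), by simp⟩, fun h => by simpa [v₁] using congrArg Subtype.val h⟩
  have hθ : Function.Bijective θ := by
    constructor
    · intro a b hab
      exact Sum.inl_injective (ι.injective (congrArg (fun z => z.1.1) hab))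
    · rintro ⟨⟨z, hz⟩, hz'⟩
      obtain ⟨z | i, rfl⟩ := ι.surjective z
      · exact ⟨z, rfl⟩
      · fin_cases i
        · exact (hz rfl).elim
        · exact (hz' rfl).elim
  have hL : ∀ a b : L.V, L.adj a b = K.adj a.1 b.1 +
      K.adj a.1 (ι (.inr 0)) * K.adj (ι (.inr 0)) b.1 :=
    adj_collapse K _ hnl
  refine ⟨(Equiv.ofBijective θ hθ).symm.trans φ, fun x y => ?_⟩
  obtain ⟨x, rfl⟩ := hθ.2 x
  obtain ⟨y, rfl⟩ := hθ.2 y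
  have hx : ∀ x, (Equiv.ofBijective θ hθ).symm (θ x) = x :=
    (Equiv.ofBijective θ hθ).symm_apply_apply
  rw [Equiv.trans_apply, Equiv.trans_apply, hx, hx, hφ]
  change _ = L.adj (θ x).1 (θ y).1 + L.adj (θ x).1 v₁ * L.adj v₁ (θ y).1
  rw [hL, hL, hL]
  simp only [θ, v₁, hll, hrr, ← hlr]
  ring

/-- The edges emitted by a vertex without edges to the collapsed vertex are unaffected by
the collapse. -/
theorem card_emit_collapse (K : CKGraph) (u : K.V) (hnl : ∀ e, K.s e = u → K.r e ≠ u)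
    (z : K.V) (hz : z ≠ u) (hzu : ∀ e, K.s e = z → K.r e ≠ u) :
    Nat.card {e // (K.collapse u hnl).s e = ⟨z, hz⟩} = Nat.card {e // K.s e = z} := by
  refine Nat.card_congr ⟨fun a => match a with
    | ⟨.inl e, h⟩ => ⟨e.1, congrArg Subtype.val h⟩
    | ⟨.inr p, h⟩ => (hzu p.1.1 (congrArg Subtype.val h) p.1.2).elim,
    fun e => ⟨.inl ⟨e.1, hzu e.1 e.2, by rw [e.2]; exact hz⟩, Subtype.ext e.2⟩, ?_, ?_⟩
  · rintro ⟨e | p, h⟩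
    · rfl
    · exact (hzu p.1.1 (congrArg Subtype.val h) p.1.2).elim
  · rintro _
    rfl

theorem moveEquiv_of_card_emit_eq_one_of_forall (G H : CKGraph) (hfin : Finite G.V) (u : G.V)
    (hcard : Nat.card {e // G.s e = u} = 1) (hnl : ∀ e, G.s e = u → G.r e ≠ u) (v : G.V)
    (hin : ∀ e, G.r e = u → G.s e = v) (hH : IsCollapse G u H) : MoveEquiv G H := by
  obtain ⟨hsub, ⟨f, hf⟩⟩ := Nat.card_eq_one_iff_unique.1 hcard
  have honly : ∀ e, G.s e = u → e = f := fun e he =>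
    congrArg Subtype.val (hsub.elim ⟨e, he⟩ ⟨f, hf⟩)
  exact .moveR hfin u f hf (hnl f hf) honly v hin
    (hH.nonempty_iso (isCollapse_reduce G u f hf (hnl f hf) honly v hin))

theorem regular_of_card_emit_ne_zero (G : CKGraph) (v : G.V)
    (h : Nat.card {e // G.s e = v} ≠ 0) : G.Regular v := by
  obtain ⟨⟨e, he⟩⟩ := (Nat.card_ne_zero.1 h).1
  exact ⟨⟨e, he⟩, (Nat.card_ne_zero.1 h).2⟩

section InSplit

variable (G : CKGraph) (v : G.V) (n : ℕ) (P : {e : G.E // G.r e = v} → Fin n)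

/-- The vertex of `G` from which a vertex of an in-split of `G` stems. -/
def inSplitVertex : (G.inSplit v n P).V → G.V :=
  Sum.elim (fun w => w.1) (fun _ => v)

/-- The edge of `G` from which an edge of an in-split of `G` stems. -/
def inSplitEdge : (G.inSplit v n P).E → G.E :=
  Sum.elim (fun e => e.1) (fun p => p.1.1)

theorem inSplit_r_eq_inl (e : (G.inSplit v n P).E) (x : {w : G.V // w ≠ v}) :
    (G.inSplit v n P).r e = Sum.inl x ↔ G.r (inSplitEdge G v n P e) = x := by
  obtain ⟨x, hx⟩ := x
  rcases e with e | e <;> simp only [inSplit, inSplitEdge, Sum.elim_inl, Sum.elim_inr] <;>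
    split_ifs with h <;> simp [h, hx.symm]

theorem inSplit_r_eq_inr (e : (G.inSplit v n P).E) (i : Fin n) :
    (G.inSplit v n P).r e = Sum.inr i ↔
      ∃ h : G.r (inSplitEdge G v n P e) = v, P ⟨inSplitEdge G v n P e, h⟩ = i := by
  rcases e with e | e <;> simp only [inSplit, inSplitEdge, Sum.elim_inl, Sum.elim_inr] <;>
    split_ifs with h <;> simp [h]

theorem bijective_inSplitEdge (a : (G.inSplit v n P).V) (Q : G.E → Prop) :
    Function.Bijective (fun e : {e // (G.inSplit v n P).s e = a ∧ Q (inSplitEdge G v n P e)} =>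
      (⟨inSplitEdge G v n P e.1, by
        obtain ⟨e | p, rfl, h⟩ := e
        · exact ⟨rfl, h⟩
        · exact ⟨p.1.2, h⟩⟩ :
        {e // G.s e = inSplitVertex G v n P a ∧ Q e})) := by
  constructor
  · rintro ⟨e | ⟨p, i⟩, rfl, h⟩ ⟨e' | ⟨p', i'⟩, h1, h'⟩ hee
    · have h1 := congrArg Subtype.val hee
      obtain rfl : e = e' := Subtype.ext h1
      rfl
    · cases h1
    · cases h1
    · have h2 := congrArg Subtype.val hee
      obtain rfl : p = p' := Subtype.ext h2
      obtain rfl : i' = i := Sum.inr_injective h1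
      rfl
  · rintro ⟨e, he, hQ⟩
    rcases a with x | i
    · exact ⟨⟨.inl ⟨e, by rw [he]; exact x.2⟩, congrArg Sum.inl (Subtype.ext he), hQ⟩, rfl⟩
    · exact ⟨⟨.inr (⟨e, he⟩, i), rfl, hQ⟩, rfl⟩

theorem mk_inSplit (a : (G.inSplit v n P).V) (Q : G.E → Prop) :
    Cardinal.mk {e // (G.inSplit v n P).s e = a ∧ Q (inSplitEdge G v n P e)} =
      Cardinal.mk {e // G.s e = inSplitVertex G v n P a ∧ Q e} :=
  Cardinal.mk_congr (Equiv.ofBijective _ (bijective_inSplitEdge G v n P a Q))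

theorem card_emit_inSplit (i : Fin n) :
    Nat.card {e // (G.inSplit v n P).s e = Sum.inr i} = Nat.card {e // G.s e = v} := by
  have h := mk_inSplit G v n P (.inr i) (fun _ => True)
  simp only [and_true] at h
  exact congrArg Cardinal.toNat h

theorem adj_inSplit_inl (a : (G.inSplit v n P).V) (y : {w : G.V // w ≠ v}) :
    (G.inSplit v n P).adj a (Sum.inl y) = G.adj (inSplitVertex G v n P a) y := by
  unfold adj
  simp only [inSplit_r_eq_inl]
  exact mk_inSplit G v n P a (fun e => G.r e = y)

theorem adj_inSplit_inr (a : (G.inSplit v n P).V) (i : Fin n) :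
    (G.inSplit v n P).adj a (Sum.inr i) =
      Cardinal.mk {e // G.s e = inSplitVertex G v n P a ∧ ∃ h : G.r e = v, P ⟨e, h⟩ = i} := by
  unfold adj
  simp only [inSplit_r_eq_inr]
  exact mk_inSplit G v n P a (fun e => ∃ h : G.r e = v, P ⟨e, h⟩ = i)

theorem not_inSplit_inr_loop (hnl : ∀ e, G.s e = v → G.r e ≠ v) (i j : Fin n)
    (e : (G.inSplit v n P).E) (he : (G.inSplit v n P).s e = Sum.inr i) :
    (G.inSplit v n P).r e ≠ Sum.inr j := by
  intro hr
  obtain ⟨h, -⟩ := (inSplit_r_eq_inr G v n P e j).1 hr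
  rcases e with e | p
  · cases he
  · exact hnl _ p.1.2 h

end InSplit

section OutSplit

variable (G : CKGraph) (v : G.V) (n : ℕ) (P : {e : G.E // G.s e = v} → Fin n)

/-- The vertex of `G` from which a vertex of an out-split of `G` stems. -/
def outSplitVertex : (G.outSplit v n P).V → G.V :=
  Sum.elim (fun w => w.1) (fun _ => v)

/-- The edge of `G` from which an edge of an out-split of `G` stems. -/
def outSplitEdge : (G.outSplit v n P).E → G.E :=
  Sum.elim (fun e => e.1) (fun p => p.1.1)

theorem outSplit_s_eq_inl (e : (G.outSplit v n P).E) (x : {w : G.V // w ≠ v}) :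
    (G.outSplit v n P).s e = Sum.inl x ↔ G.s (outSplitEdge G v n P e) = x := by
  obtain ⟨x, hx⟩ := x
  rcases e with e | e <;> simp only [outSplit, outSplitEdge, Sum.elim_inl, Sum.elim_inr] <;>
    split_ifs with h <;> simp [h, hx.symm]

theorem outSplit_s_eq_inr (e : (G.outSplit v n P).E) (i : Fin n) :
    (G.outSplit v n P).s e = Sum.inr i ↔
      ∃ h : G.s (outSplitEdge G v n P e) = v, P ⟨outSplitEdge G v n P e, h⟩ = i := by
  rcases e with e | e <;> simp only [outSplit, outSplitEdge, Sum.elim_inl, Sum.elim_inr] <;>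
    split_ifs with h <;> simp [h]

theorem bijective_outSplitEdge (a : (G.outSplit v n P).V) (Q : G.E → Prop) :
    Function.Bijective (fun e : {e // Q (outSplitEdge G v n P e) ∧ (G.outSplit v n P).r e = a} =>
      (⟨outSplitEdge G v n P e.1, by
        obtain ⟨e | p, h, rfl⟩ := e
        · exact ⟨h, rfl⟩
        · exact ⟨h, p.1.2⟩⟩ :
        {e // Q e ∧ G.r e = outSplitVertex G v n P a})) := by
  constructor
  · rintro ⟨e | ⟨p, i⟩, h, rfl⟩ ⟨e' | ⟨p', i'⟩, h', h1⟩ hee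
    · have h1 := congrArg Subtype.val hee
      obtain rfl : e = e' := Subtype.ext h1
      rfl
    · cases h1
    · cases h1
    · have h2 := congrArg Subtype.val hee
      obtain rfl : p = p' := Subtype.ext h2
      obtain rfl : i' = i := Sum.inr_injective h1
      rfl
  · rintro ⟨e, hQ, he⟩
    rcases a with x | i
    · exact ⟨⟨.inl ⟨e, by rw [he]; exact x.2⟩, hQ, congrArg Sum.inl (Subtype.ext he)⟩, rfl⟩
    · exact ⟨⟨.inr (⟨e, he⟩, i), hQ, rfl⟩, rfl⟩

theorem mk_outSplit (a : (G.outSplit v n P).V) (Q : G.E → Prop) :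
    Cardinal.mk {e // Q (outSplitEdge G v n P e) ∧ (G.outSplit v n P).r e = a} =
      Cardinal.mk {e // Q e ∧ G.r e = outSplitVertex G v n P a} :=
  Cardinal.mk_congr (Equiv.ofBijective _ (bijective_outSplitEdge G v n P a Q))

theorem adj_outSplit_inl (x : {w : G.V // w ≠ v}) (a : (G.outSplit v n P).V) :
    (G.outSplit v n P).adj (Sum.inl x) a = G.adj x (outSplitVertex G v n P a) := by
  unfold adj
  simp only [outSplit_s_eq_inl]
  exact mk_outSplit G v n P a (fun e => G.s e = x)

theorem adj_outSplit_inr (i : Fin n) (a : (G.outSplit v n P).V) :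
    (G.outSplit v n P).adj (Sum.inr i) a =
      Cardinal.mk {e // (∃ h : G.s e = v, P ⟨e, h⟩ = i) ∧ G.r e = outSplitVertex G v n P a} := by
  unfold adj
  simp only [outSplit_s_eq_inr]
  exact mk_outSplit G v n P a (fun e => ∃ h : G.s e = v, P ⟨e, h⟩ = i)

theorem not_outSplit_inr_loop (hnl : ∀ e, G.s e = v → G.r e ≠ v) (i j : Fin n)
    (e : (G.outSplit v n P).E) (he : (G.outSplit v n P).s e = Sum.inr i) :
    (G.outSplit v n P).r e ≠ Sum.inr j := by
  rw [outSplit_s_eq_inr] at he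
  obtain ⟨h, -⟩ := he
  rcases e with e | p
  · rintro ⟨⟩
  · exact (hnl _ h p.1.2).elim

theorem card_emit_outSplit (hnl : ∀ e, G.s e = v → G.r e ≠ v) (i : Fin n) :
    Nat.card {e // (G.outSplit v n P).s e = Sum.inr i} = Nat.card {e // P e = i} := by
  refine Nat.card_congr ⟨fun e => ⟨⟨outSplitEdge G v n P e.1,
      ((outSplit_s_eq_inr G v n P e.1 i).1 e.2).1⟩,
      ((outSplit_s_eq_inr G v n P e.1 i).1 e.2).2⟩,
    fun e => ⟨.inl ⟨e.1.1, hnl _ e.1.2⟩, (outSplit_s_eq_inr G v n P _ i).2 ⟨e.1.2, e.2⟩⟩, ?_, ?_⟩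
  · rintro ⟨e | p, h⟩
    · rfl
    · exact (hnl _ ((outSplit_s_eq_inr G v n P _ i).1 h).1 p.1.2).elim
  · rintro _
    rfl

end OutSplit

/-- Splitting a set of edges according to a two-valued partition. -/
theorem mk_add_mk_fin_two {α : Type} {R T : α → Prop} (P : {e // T e} → Fin 2) :
    Cardinal.mk {e // R e ∧ ∃ h : T e, P ⟨e, h⟩ = 0} +
      Cardinal.mk {e // R e ∧ ∃ h : T e, P ⟨e, h⟩ = 1} = Cardinal.mk {e // R e ∧ T e} := by
  change Cardinal.mk ({e | R e ∧ ∃ h : T e, P ⟨e, h⟩ = 0} : Set α) +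
    Cardinal.mk ({e | R e ∧ ∃ h : T e, P ⟨e, h⟩ = 1} : Set α) =
    Cardinal.mk ({e | R e ∧ T e} : Set α)
  rw [← Cardinal.mk_union_of_disjoint]
  · congr 2
    ext e
    constructor
    · rintro (⟨h, h', -⟩ | ⟨h, h', -⟩) <;> exact ⟨h, h'⟩
    · rintro ⟨h, h'⟩
      rcases Fin.exists_fin_two.1 ⟨P ⟨e, h'⟩, rfl⟩ with h0 | h0
      · exact .inl ⟨h, h', h0⟩
      · exact .inr ⟨h, h', h0⟩
  · rw [Set.disjoint_left]
    rintro e ⟨-, h, h0⟩ ⟨-, h', h1⟩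
    rw [h0] at h1
    exact absurd h1 (by decide)

theorem moveEquiv_of_card_emit_eq_one (n : ℕ) : ∀ (G H : CKGraph) (_ : Finite G.V) (v : G.V)
    (_ : Nat.card {e // G.s e = v} = 1) (_ : ∀ e, G.s e = v → G.r e ≠ v) (g : Fin n → G.V)
    (_ : ∀ e, G.r e = v → G.s e ∈ Set.range g) (_ : IsCollapse G v H), MoveEquiv G H := by
  classical
  induction n with
  | zero =>
    intro G H hfin v hcard hnl g hg hH
    refine moveEquiv_of_card_emit_eq_one_of_forall G H hfin v hcard hnl v (fun e he => ?_) hH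
    exact (hg e he).elim fun i => i.elim0
  | succ n ih =>
    intro G H hfin v hcard hnl g hg hH
    by_cases h1 : ∀ e, G.r e = v → G.s e = g 0
    · exact moveEquiv_of_card_emit_eq_one_of_forall G H hfin v hcard hnl _ h1 hH
    have htail : ∀ e, G.r e = v → G.s e ≠ g 0 → ∃ i : Fin n, g i.succ = G.s e := by
      intro e he hne
      obtain ⟨i, hi⟩ := hg e he
      rcases Fin.eq_zero_or_eq_succ i with rfl | ⟨j, rfl⟩
      · exact (hne hi.symm).elim
      · exact ⟨j, hi⟩
    by_cases h2 : ∃ e, G.r e = v ∧ G.s e = g 0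
    swap
    · exact ih G H hfin v hcard hnl (g ∘ Fin.succ)
        (fun e he => htail e he fun h => h2 ⟨e, he, h⟩) hH
    push Not at h1
    obtain ⟨e₁, he₁, hne₁⟩ := h1
    obtain ⟨e₀, he₀, heq₀⟩ := h2
    let P : {e : G.E // G.r e = v} → Fin 2 := fun e => if G.s e.1 = g 0 then 0 else 1
    have hP : Function.Surjective P := Fin.forall_fin_two.2
      ⟨⟨⟨e₀, he₀⟩, if_pos heq₀⟩, ⟨⟨e₁, he₁⟩, if_neg hne₁⟩⟩
    let K := G.inSplit v 2 P
    have hKfin : Finite K.V := inferInstanceAs (Finite ({w : G.V // w ≠ v} ⊕ Fin 2))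
    have hKnl : ∀ i j (e : K.E), K.s e = Sum.inr i → K.r e ≠ Sum.inr j :=
      not_inSplit_inr_loop G v 2 P hnl
    have hGK : MoveEquiv G K := .moveI hfin v
      (regular_of_card_emit_ne_zero G v (by rw [hcard]; exact one_ne_zero))
      (fun h => h e₀ he₀) 2 P hP ⟨⟨Equiv.refl _, Equiv.refl _, fun _ => rfl, fun _ => rfl⟩⟩
    have hg0 : g 0 ≠ v := fun h => hnl e₀ (heq₀.trans h) he₀
    let L := K.collapse (Sum.inr 0) (hKnl 0 0)
    have hLfin : Finite L.V := inferInstanceAs (Finite {w : K.V // w ≠ Sum.inr 0})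
    have hKL : MoveEquiv K L := by
      refine moveEquiv_of_card_emit_eq_one_of_forall K L hKfin (Sum.inr 0)
        ((card_emit_inSplit G v 2 P 0).trans hcard) (hKnl 0 0) (Sum.inl ⟨g 0, hg0⟩) ?_
        (isCollapse_collapse K _ _)
      intro e he
      obtain ⟨h, h0⟩ := (inSplit_r_eq_inr G v 2 P e 0).1 he
      have h0 : G.s (inSplitEdge G v 2 P e) = g 0 := by
        by_contra hne
        simp [P, hne] at h0
      rcases e with e | p
      · exact congrArg Sum.inl (Subtype.ext h0)
      · exact (hnl _ p.1.2 h).elim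
    have h10 : (Sum.inr 1 : K.V) ≠ Sum.inr 0 := fun h => by cases h
    refine hGK.trans (hKL.trans ?_)
    have hLc : Nat.card {e // L.s e = ⟨Sum.inr 1, h10⟩} = 1 :=
      (card_emit_collapse K (Sum.inr 0) (hKnl 0 0) (Sum.inr 1) h10 (hKnl 1 0)).trans
        ((card_emit_inSplit G v 2 P 1).trans hcard)
    refine ih L H hLfin ⟨Sum.inr 1, h10⟩ hLc ?_
      (fun i => if h : g i.succ = v then ⟨Sum.inr 1, h10⟩
        else ⟨Sum.inl ⟨g i.succ, h⟩, fun h => by cases h⟩) ?_ ?_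
    · rintro (e | p) he hr
      · exact hKnl 1 1 e.1 (congrArg Subtype.val he) (congrArg Subtype.val hr)
      · exact hKnl 1 0 p.1.1 (congrArg Subtype.val he) p.1.2
    · rintro (e | p) hr
      · obtain ⟨h, h0⟩ := (inSplit_r_eq_inr G v 2 P e.1 1).1 (congrArg Subtype.val hr)
        have hne : G.s (inSplitEdge G v 2 P e.1) ≠ g 0 := fun heq => by simp [P, heq] at h0
        obtain ⟨i, hi⟩ := htail _ h hne
        have hv : g i.succ ≠ v := fun h' => hnl _ (hi.symm.trans h') h
        refine ⟨i, (dif_neg hv).trans (Subtype.ext ?_)⟩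
        obtain ⟨e | p, _⟩ := e
        · have hi' : (⟨g i.succ, hv⟩ : {w // w ≠ v}) = ⟨G.s e.1, e.2⟩ := Subtype.ext hi
          exact congrArg Sum.inl hi'
        · exact (hnl _ p.1.2 h).elim
      · exact (hKnl 0 1 p.2.1 p.2.2 (congrArg Subtype.val hr)).elim
    · refine hH.of_split (K := K) (Equiv.refl _) (hKnl 0 0)
        (fun x y => adj_inSplit_inl G v 2 P (.inl x) y) (fun i j => ?_) (fun x y => ?_) h10
      · exact Cardinal.mk_eq_zero_iff.2 ⟨fun e => hKnl i j e.1 e.2.1 e.2.2⟩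
      · refine (congrArg₂ (· + ·)
          (congrArg₂ (· * ·) (adj_inSplit_inr G v 2 P (.inl x) 0) (adj_inSplit_inl G v 2 P (.inr 0) y))
          (congrArg₂ (· * ·) (adj_inSplit_inr G v 2 P (.inl x) 1) (adj_inSplit_inl G v 2 P (.inr 1) y))).trans ?_
        change _ * G.adj v y + _ * G.adj v y = _
        rw [← add_mul, mk_add_mk_fin_two]
        rfl

theorem moveEquiv_of_isCollapse (n : ℕ) : ∀ (G H : CKGraph) (_ : Finite G.V) (v : G.V)
    (_ : Nat.card {e // G.s e = v} = n + 1) (_ : ∀ e, G.s e = v → G.r e ≠ v)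
    (_ : IsCollapse G v H), MoveEquiv G H := by
  classical
  have hone : ∀ (G H : CKGraph) (_ : Finite G.V) (v : G.V)
      (_ : Nat.card {e // G.s e = v} = 1) (_ : ∀ e, G.s e = v → G.r e ≠ v)
      (_ : IsCollapse G v H), MoveEquiv G H := by
    intro G H hfin v hcard hnl hH
    obtain ⟨m, ⟨σ⟩⟩ := Finite.exists_equiv_fin G.V
    exact moveEquiv_of_card_emit_eq_one m G H hfin v hcard hnl σ.symm
      (fun e _ => σ.symm.surjective _) hH
  induction n with
  | zero => exact hone
  | succ n ih =>
    intro G H hfin v hcard hnl hH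
    have hEfin : Finite {e // G.s e = v} := Nat.finite_of_card_ne_zero (by omega)
    have : Nontrivial {e // G.s e = v} := (Finite.one_lt_card_iff_nontrivial).1 (by omega)
    obtain ⟨f, f', hff'⟩ := exists_pair_ne {e // G.s e = v}
    let P : {e : G.E // G.s e = v} → Fin 2 := fun e => if e = f then 0 else 1
    have hP : Function.Surjective P := Fin.forall_fin_two.2
      ⟨⟨f, if_pos rfl⟩, ⟨f', if_neg hff'.symm⟩⟩
    have hP0 : ∀ e, P e = 0 ↔ e = f := fun e => by by_cases h : e = f <;> simp [P, h]
    have hP1 : ∀ e, P e = 1 ↔ ¬ e = f := fun e => by by_cases h : e = f <;> simp [P, h]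
    let K := G.outSplit v 2 P
    have hKfin : Finite K.V := inferInstanceAs (Finite ({w : G.V // w ≠ v} ⊕ Fin 2))
    have hKnl : ∀ i j (e : K.E), K.s e = Sum.inr i → K.r e ≠ Sum.inr j :=
      not_outSplit_inr_loop G v 2 P hnl
    have hGK : MoveEquiv G K := .moveO hfin v (fun h => h f.1 f.2) 2 P hP
      (fun i _ hi => (hi (Set.toFinite _)).elim)
      ⟨⟨Equiv.refl _, Equiv.refl _, fun _ => rfl, fun _ => rfl⟩⟩
    let L := K.collapse (Sum.inr 0) (hKnl 0 0)
    have hLfin : Finite L.V := inferInstanceAs (Finite {w : K.V // w ≠ Sum.inr 0})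
    have hKL : MoveEquiv K L := by
      refine hone K L hKfin (Sum.inr 0) ((card_emit_outSplit G v 2 P hnl 0).trans ?_)
        (hKnl 0 0) (isCollapse_collapse K _ _)
      simp only [hP0]
      simp
    have h10 : (Sum.inr 1 : K.V) ≠ Sum.inr 0 := fun h => by cases h
    refine hGK.trans (hKL.trans ?_)
    have hLc : Nat.card {e // L.s e = ⟨Sum.inr 1, h10⟩} = n + 1 := by
      refine (card_emit_collapse K (Sum.inr 0) (hKnl 0 0) (Sum.inr 1) h10 (hKnl 1 0)).trans
        ((card_emit_outSplit G v 2 P hnl 1).trans ?_)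
      simp only [hP1]
      have := Fintype.ofFinite {e // G.s e = v}
      rw [Nat.card_eq_fintype_card] at hcard ⊢
      rw [Fintype.card_subtype_compl, Fintype.card_subtype_eq, hcard]
      rfl
    refine ih L H hLfin ⟨Sum.inr 1, h10⟩ hLc ?_ ?_
    · rintro (e | p) he hr
      · exact hKnl 1 1 e.1 (congrArg Subtype.val he) (congrArg Subtype.val hr)
      · exact hKnl 1 0 p.1.1 (congrArg Subtype.val he) p.1.2
    · refine hH.of_split (K := K) (Equiv.refl _) (hKnl 0 0)
        (fun x y => adj_outSplit_inl G v 2 P x (.inl y)) (fun i j => ?_) (fun x y => ?_) h10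
      · exact Cardinal.mk_eq_zero_iff.2 ⟨fun e => hKnl i j e.1 e.2.1 e.2.2⟩
      · refine (congrArg₂ (· + ·)
          (congrArg₂ (· * ·) (adj_outSplit_inl G v 2 P x (.inr 0)) (adj_outSplit_inr G v 2 P 0 (.inl y)))
          (congrArg₂ (· * ·) (adj_outSplit_inl G v 2 P x (.inr 1)) (adj_outSplit_inr G v 2 P 1 (.inl y)))).trans ?_
        change G.adj x v * _ + G.adj x v * _ = _
        simp only [and_comm (b := G.r _ = _)]
        rw [← mul_add, mk_add_mk_fin_two]
        simp only [and_comm (a := G.r _ = _)]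
        rfl

/-- Collapsing a regular vertex that does not support a loop of length one preserves
move-equivalence. -/
theorem moveEquiv_collapse (G : CKGraph) (hfin : Finite G.V) (v : G.V) (hreg : G.Regular v)
    (hnl : ∀ e, G.s e = v → G.r e ≠ v) : MoveEquiv G (G.collapse v hnl) := by
  obtain ⟨⟨e, he⟩, hE⟩ := hreg
  have : Finite {e // G.s e = v} := hE
  have : Nonempty {e // G.s e = v} := ⟨⟨e, he⟩⟩
  obtain ⟨n, hn⟩ := Nat.exists_eq_succ_of_ne_zero (Nat.card_pos (α := {e // G.s e = v})).ne'
  exact moveEquiv_of_isCollapse n G _ hfin v hn hnl (isCollapse_collapse G v hnl)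

theorem not_isSink_collapse (G : CKGraph) (v : G.V) (hnl : ∀ e, G.s e = v → G.r e ≠ v)
    (h : ∀ w, ¬ G.IsSink w) (w : (G.collapse v hnl).V) : ¬ (G.collapse v hnl).IsSink w := by
  have hex : ∀ w, ∃ e, G.s e = w := fun w => by simpa [IsSink] using h w
  obtain ⟨w, hw⟩ := w
  obtain ⟨e, rfl⟩ := hex w
  intro hs
  by_cases her : G.r e = v
  · obtain ⟨f, hf⟩ := hex v
    exact hs (.inr (⟨e, her⟩, ⟨f, hf⟩)) rfl
  · exact hs (.inl ⟨e, her, hw⟩) rfl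

theorem not_isSource_collapse (G : CKGraph) (v : G.V) (hnl : ∀ e, G.s e = v → G.r e ≠ v)
    (h : ∀ w, ¬ G.IsSource w) (w : (G.collapse v hnl).V) :
    ¬ (G.collapse v hnl).IsSource w := by
  have hex : ∀ w, ∃ e, G.r e = w := fun w => by simpa [IsSource] using h w
  obtain ⟨w, hw⟩ := w
  obtain ⟨e, rfl⟩ := hex w
  intro hs
  by_cases hes : G.s e = v
  · obtain ⟨f, hf⟩ := hex v
    exact hs (.inr (⟨f, hf⟩, ⟨e, hes⟩)) rfl
  · exact hs (.inl ⟨e, hw, hes⟩) rfl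

end CKGraph

/-- a graph with finitely many vertices, no sinks and no sources is
move-equivalent to a graph with no more vertices, no sinks, no sources, in which
every regular vertex supports a loop of length one. -/
theorem stmt5 (G : CKGraph) (hfin : Finite G.V)
    (hsink : ∀ v : G.V, ¬ G.IsSink v) (hsource : ∀ v : G.V, ¬ G.IsSource v) :
    ∃ E : CKGraph, Finite E.V ∧ Nat.card E.V ≤ Nat.card G.V ∧
      (∀ v : E.V, ¬ E.IsSink v) ∧ (∀ v : E.V, ¬ E.IsSource v) ∧
      (∀ v : E.V, E.Regular v → ∃ e : E.E, E.s e = v ∧ E.r e = v) ∧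
      CKGraph.MoveEquiv G E := by
  induction hn : Nat.card G.V using Nat.strong_induction_on generalizing G with
  | _ n ih =>
  subst hn
  by_cases hall : ∀ v : G.V, G.Regular v → ∃ e : G.E, G.s e = v ∧ G.r e = v
  · exact ⟨G, hfin, le_rfl, hsink, hsource, hall, .of_iso hfin
      ⟨⟨Equiv.refl _, Equiv.refl _, fun _ => rfl, fun _ => rfl⟩⟩⟩
  push Not at hall
  obtain ⟨v, hreg, hnl⟩ := hall
  have hlt : Nat.card (G.collapse v hnl).V < Nat.card G.V :=
    Finite.card_subtype_lt (x := v) (p := fun w => w ≠ v) (by simp)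
  obtain ⟨E, hE, hcard, h1, h2, h3, h4⟩ := ih _ hlt (G.collapse v hnl)
    (inferInstanceAs (Finite {w : G.V // w ≠ v}))
    (G.not_isSink_collapse v hnl hsink) (G.not_isSource_collapse v hnl hsource) rfl
  exact ⟨E, hE, hcard.trans hlt.le, h1, h2, h3,
    (G.moveEquiv_collapse hfin v hreg hnl).trans h4⟩
end
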